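/- arXiv:2506.17704 — 2 statements merged into one kernel-verified Lean document; each statement's English description precedes it below -/
import Mathlib

section
/- T_{max,2}(15) = 69 and T_{max,3}(15) = 81; in particular, for l = 15 the function m1 ↦ T_{max,m1}(15) is strictly increasing on {1, 2, 3}. -/
open MvPolynomial

/-- A monomial ideal: an ideal containing the monomials of all its elements. -/
def IsMonomialIdeal (I : Ideal (MvPolynomial (Fin 3) ℂ)) : Prop :=
  ∀ p ∈ I, ∀ d ∈ p.support, (monomial d (1 : ℂ)) ∈ I

/-- Borel-fixed (strongly stable) in characteristic 0: for every monomial in `I`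
divisible by `x_j`, and every `i < j`, replacing one factor `x_j` by `x_i`
stays in `I`. -/
def IsBorelFixed (I : Ideal (MvPolynomial (Fin 3) ℂ)) : Prop :=
  ∀ d : Fin 3 →₀ ℕ, (monomial d (1 : ℂ)) ∈ I →
    ∀ i j : Fin 3, i < j → 0 < d j →
      (monomial (d + Finsupp.single i 1 - Finsupp.single j 1) (1 : ℂ)) ∈ I

/-- The dimension of the tangent space to the Hilbert scheme at `[I]`,
namely `dim_ℂ Hom_R(I, R/I)`. -/
noncomputable def tangentDim (I : Ideal (MvPolynomial (Fin 3) ℂ)) : ℕ :=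
  Module.finrank ℂ (↥I →ₗ[MvPolynomial (Fin 3) ℂ] (MvPolynomial (Fin 3) ℂ ⧸ I))

/-- `TmaxEq l m1 T` says that `T` is the maximum of `dim_ℂ Hom_R(I, R/I)` over all
Borel-fixed monomial ideals `I ⊆ ℂ[x,y,z]` of colength `l` whose smallest pure power
of `x` lying in `I` is `x^{m1}`. -/
def TmaxEq (l m1 T : ℕ) : Prop :=
  IsGreatest { t : ℕ | ∃ I : Ideal (MvPolynomial (Fin 3) ℂ),
      IsMonomialIdeal I ∧ IsBorelFixed I ∧
      Module.finrank ℂ (MvPolynomial (Fin 3) ℂ ⧸ I) = l ∧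
      (X 0 : MvPolynomial (Fin 3) ℂ) ^ m1 ∈ I ∧
      (X 0 : MvPolynomial (Fin 3) ℂ) ^ (m1 - 1) ∉ I ∧
      t = tangentDim I } T

namespace Staircase

/-- Exponents `(a, b, c)` of the monomials `x^a y^b z^c`. -/
abbrev Exponent := ℕ × ℕ × ℕ

/-- An exponent as a finitely supported function on the variables. -/
noncomputable def toFinsupp (m : Exponent) : Fin 3 →₀ ℕ :=
  Finsupp.equivFunOnFinite.symm ![m.1, m.2.1, m.2.2]

/-- A finitely supported function on the variables as an exponent. -/
def ofFinsupp (d : Fin 3 →₀ ℕ) : Exponent := (d 0, d 1, d 2)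

@[simp] theorem ofFinsupp_toFinsupp (m : Exponent) : ofFinsupp (toFinsupp m) = m := rfl

@[simp] theorem toFinsupp_ofFinsupp (d : Fin 3 →₀ ℕ) : toFinsupp (ofFinsupp d) = d := by
  ext i; fin_cases i <;> rfl

theorem toFinsupp_injective : Function.Injective toFinsupp :=
  Function.LeftInverse.injective ofFinsupp_toFinsupp

@[simp] theorem toFinsupp_inj {m n : Exponent} : toFinsupp m = toFinsupp n ↔ m = n :=
  toFinsupp_injective.eq_iff

theorem toFinsupp_add (m n : Exponent) : toFinsupp (m + n) = toFinsupp m + toFinsupp n := by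
  ext i; fin_cases i <;> rfl

theorem toFinsupp_sub (m n : Exponent) : toFinsupp (m - n) = toFinsupp m - toFinsupp n := by
  ext i; fin_cases i <;> rfl

theorem toFinsupp_le {m n : Exponent} : toFinsupp m ≤ toFinsupp n ↔ m ≤ n := by
  simp only [Finsupp.le_def, Fin.forall_fin_succ, Prod.le_def]
  simp [toFinsupp]

theorem le_iff (m n : Exponent) : m ≤ n ↔ m.1 ≤ n.1 ∧ m.2.1 ≤ n.2.1 ∧ m.2.2 ≤ n.2.2 := by
  simp only [Prod.le_def]

/-- The monomial with a given exponent. -/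
noncomputable def mon (m : Exponent) : MvPolynomial (Fin 3) ℂ := monomial (toFinsupp m) 1

theorem mon_add (m n : Exponent) : mon (m + n) = mon m * mon n := by
  simp [mon, toFinsupp_add, monomial_mul]

theorem X_zero_pow (k : ℕ) : (X 0 : MvPolynomial (Fin 3) ℂ) ^ k = mon (k, 0, 0) := by
  rw [X_pow_eq_monomial, mon]
  have : Finsupp.single (0 : Fin 3) k = toFinsupp (k, 0, 0) := by
    ext i; fin_cases i <;> simp [toFinsupp]
  rw [this]

theorem coeff_mon (m n : Exponent) :
    coeff (toFinsupp n) (mon m) = if m = n then 1 else 0 := by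
  classical
  rw [mon, coeff_monomial]
  simp

theorem coeff_mon_mul (u m : Exponent) (f : MvPolynomial (Fin 3) ℂ) :
    coeff (toFinsupp m) (mon u * f) = if u ≤ m then coeff (toFinsupp (m - u)) f else 0 := by
  classical
  rw [mon, coeff_monomial_mul']
  simp [toFinsupp_le, toFinsupp_sub]

variable {I : Ideal (MvPolynomial (Fin 3) ℂ)} {σ : Exponent → Prop}

/-- `I` is the monomial ideal whose standard monomials have the exponents in `σ`. -/
def HasStandard (I : Ideal (MvPolynomial (Fin 3) ℂ)) (σ : Exponent → Prop) : Prop :=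
  ∀ p, p ∈ I ↔ ∀ m, σ m → coeff (toFinsupp m) p = 0

theorem HasStandard.mon_mem (hI : HasStandard I σ) {m : Exponent} : mon m ∈ I ↔ ¬ σ m := by
  rw [hI]
  constructor
  · intro h hm
    simpa [coeff_mon] using h m hm
  · intro h n hn
    rw [coeff_mon, if_neg]
    rintro rfl
    exact h hn

theorem HasStandard.of_le (hI : HasStandard I σ) {m n : Exponent} (hn : σ n) (h : m ≤ n) :
    σ m := by
  by_contra hm
  refine hI.mon_mem.1 ?_ hn
  rw [← tsub_add_cancel_of_le h, mon_add]
  exact I.mul_mem_left _ (hI.mon_mem.2 hm)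

theorem _root_.IsMonomialIdeal.hasStandard (hI : IsMonomialIdeal I) :
    HasStandard I (fun m => mon m ∉ I) := by
  intro p
  constructor
  · intro hp m hm
    by_contra h
    exact hm (hI p hp _ (mem_support_iff.2 h))
  · intro h
    rw [p.as_sum]
    refine I.sum_mem fun d hd => ?_
    have hd' : mon (ofFinsupp d) ∈ I := by
      by_contra hc
      exact mem_support_iff.1 hd (by simpa using h _ hc)
    have := I.mul_mem_left (C (coeff d p)) hd'
    rwa [mon, toFinsupp_ofFinsupp, C_mul_monomial, mul_one] at this

theorem HasStandard.isMonomialIdeal (hI : HasStandard I σ) : IsMonomialIdeal I := by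
  intro p hp d hd
  have : mon (ofFinsupp d) ∈ I := by
    rw [hI.mon_mem]
    intro hs
    exact mem_support_iff.1 hd (by simpa using (hI p).1 hp _ hs)
  simpa [mon] using this

open Classical in
/-- The coefficient of a standard monomial, as a functional on the quotient. -/
noncomputable def coord (hI : HasStandard I σ) (s : Exponent) :
    (MvPolynomial (Fin 3) ℂ ⧸ I) →ₗ[ℂ] ℂ :=
  (Submodule.liftQ (I.restrictScalars ℂ) (if σ s then lcoeff ℂ (toFinsupp s) else 0) (by
    intro p hp
    split_ifs with h
    · exact (hI p).1 hp s h
    · simp)) ∘ₗ (Submodule.Quotient.restrictScalarsEquiv ℂ I).symm.toLinearMap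

theorem coord_mk (hI : HasStandard I σ) {s : Exponent} (hs : σ s) (p : MvPolynomial (Fin 3) ℂ) :
    coord hI s (Ideal.Quotient.mk I p) = coeff (toFinsupp s) p := by
  classical
  change (if σ s then lcoeff ℂ (toFinsupp s) else 0) p = _
  rw [if_pos hs]
  rfl

theorem eq_zero_of_coord (hI : HasStandard I σ) {q : MvPolynomial (Fin 3) ℂ ⧸ I}
    (h : ∀ s, σ s → coord hI s q = 0) : q = 0 := by
  obtain ⟨p, rfl⟩ := Ideal.Quotient.mk_surjective q
  rw [Ideal.Quotient.eq_zero_iff_mem, hI]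
  intro m hm
  rw [← coord_mk hI hm, h m hm]

theorem coord_mon_smul (hI : HasStandard I σ) {t : Exponent} (ht : σ t) (a : Exponent)
    (q : MvPolynomial (Fin 3) ℂ ⧸ I) :
    coord hI t (mon a • q) = if a ≤ t then coord hI (t - a) q else 0 := by
  obtain ⟨p, rfl⟩ := Ideal.Quotient.mk_surjective q
  change coord hI t (Ideal.Quotient.mk I (mon a * p)) = _
  rw [coord_mk hI ht, coeff_mon_mul, coord_mk hI (hI.of_le ht tsub_le_self)]

theorem finrank_quotient (hI : HasStandard I σ) :
    Module.finrank ℂ (MvPolynomial (Fin 3) ℂ ⧸ I) = Nat.card {m // σ m} := by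
  classical
  let v : {m // σ m} → MvPolynomial (Fin 3) ℂ ⧸ I := fun m => Ideal.Quotient.mk I (mon m)
  have hli : LinearIndependent ℂ v := by
    rw [linearIndependent_iff]
    intro l hl
    ext m
    have := congrArg (coord hI m) hl
    rw [Finsupp.linearCombination_apply, Finsupp.sum, map_sum, map_zero] at this
    simp only [map_smul, v, coord_mk hI m.2, coeff_mon] at this
    simpa [← Subtype.ext_iff] using this
  have hsp : ⊤ ≤ Submodule.span ℂ (Set.range v) := by
    rintro q -
    obtain ⟨p, rfl⟩ := Ideal.Quotient.mk_surjective q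
    rw [p.as_sum, map_sum]
    refine Submodule.sum_mem _ fun d _ => ?_
    have hd : Ideal.Quotient.mk I (monomial d (coeff d p)) =
        coeff d p • Ideal.Quotient.mk I (mon (ofFinsupp d)) := by
      change _ = Ideal.Quotient.mk I (coeff d p • mon (ofFinsupp d))
      rw [mon, toFinsupp_ofFinsupp, smul_monomial, smul_eq_mul, mul_one]
    rw [hd]
    by_cases h : σ (ofFinsupp d)
    · exact Submodule.smul_mem _ _ (Submodule.subset_span ⟨⟨_, h⟩, rfl⟩)
    · rw [Ideal.Quotient.eq_zero_iff_mem.2 (hI.mon_mem.2 h), smul_zero]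
      exact Submodule.zero_mem _
  exact Module.finrank_eq_nat_card_basis (Module.Basis.mk hli hsp)

/-- The value of a homomorphism at the monomial with exponent `m`, or zero if it is not in `I`. -/
noncomputable def value (hI : HasStandard I σ)
    (Φ : ↥I →ₗ[MvPolynomial (Fin 3) ℂ] (MvPolynomial (Fin 3) ℂ ⧸ I)) (m : Exponent) :
    MvPolynomial (Fin 3) ℂ ⧸ I :=
  open Classical in if h : σ m then 0 else Φ ⟨mon m, hI.mon_mem.2 h⟩

variable (Φ : ↥I →ₗ[MvPolynomial (Fin 3) ℂ] (MvPolynomial (Fin 3) ℂ ⧸ I))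

theorem value_eq (hI : HasStandard I σ) {m : Exponent} (hm : ¬ σ m) :
    value hI Φ m = Φ ⟨mon m, hI.mon_mem.2 hm⟩ := dif_neg hm

theorem mon_smul_value (hI : HasStandard I σ) {m : Exponent} (hm : ¬ σ m) (a : Exponent) :
    mon a • value hI Φ m = value hI Φ (a + m) := by
  have h : ¬ σ (a + m) := fun h => hm (hI.of_le h le_add_self)
  rw [value_eq Φ hI hm, value_eq Φ hI h, ← map_smul]
  congr 1
  ext1
  exact (mon_add a m).symm

/-- The relation between the values at two monomials of `I` imposed by their least common
multiple. -/
theorem coord_value_eq (hI : HasStandard I σ) {g h s : Exponent} (hg : ¬ σ g) (hh : ¬ σ h)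
    (hs : σ (s + (h - g))) :
    coord hI s (value hI Φ g) =
      if g ≤ s + h then coord hI (s + h - g) (value hI Φ h) else 0 := by
  have key : (h - g) + g = (g - h) + h := by
    ext <;> simp <;> omega
  have e := mon_smul_value Φ hI hg (h - g)
  rw [key, ← mon_smul_value Φ hI hh] at e
  have e' := congrArg (coord hI (s + (h - g))) e
  rw [coord_mon_smul hI hs, coord_mon_smul hI hs, if_pos le_add_self, add_tsub_cancel_right] at e'
  rw [e']
  have h1 : g - h ≤ s + (h - g) ↔ g ≤ s + h := by
    simp only [le_iff, Prod.fst_add, Prod.snd_add, Prod.fst_sub, Prod.snd_sub]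
    omega
  have h2 : s + (h - g) - (g - h) = s + h - g := by
    ext <;> simp <;> omega
  simp only [h1, h2]

theorem eq_zero_of_value (hI : HasStandard I σ) {G : List Exponent} 
    (hG : ∀ m, ¬ σ m → ∃ g ∈ G, ¬ σ g ∧ g ≤ m) (h : ∀ g ∈ G, value hI Φ g = 0) : Φ = 0 := by
  have hmon : ∀ m, (hm : mon m ∈ I) → Φ ⟨mon m, hm⟩ = 0 := by
    intro m hm
    have hm' := hI.mon_mem.1 hm
    obtain ⟨g, hgG, hg, hgm⟩ := hG m hm'
    rw [← value_eq Φ hI hm', ← tsub_add_cancel_of_le hgm, ← mon_smul_value Φ hI hg, h g hgG,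
      smul_zero]
  have hle : I ≤ Submodule.map I.subtype (LinearMap.ker Φ) := by
    intro f hf
    rw [f.as_sum]
    refine Submodule.sum_mem _ fun d hd => ?_
    have hd' := hI.isMonomialIdeal f hf d hd
    have e : monomial d (coeff d f) =
        (C (coeff d f) : MvPolynomial (Fin 3) ℂ) • monomial d (1 : ℂ) := by
      rw [smul_eq_mul, C_mul_monomial, mul_one]
    rw [e]
    refine Submodule.smul_mem _ _ ⟨⟨_, hd'⟩, ?_, rfl⟩
    have := hmon (ofFinsupp d)
    simp only [mon, toFinsupp_ofFinsupp] at this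
    exact this hd'
  ext ⟨f, hf⟩
  obtain ⟨⟨f', hf'⟩, hk, rfl⟩ := hle hf
  exact hk

/-- Evaluation of homomorphisms at finitely many pairs of a monomial of `I` and a standard
monomial. -/
noncomputable def evaluation (hI : HasStandard I σ) (D : List (Exponent × Exponent)) :
    (↥I →ₗ[MvPolynomial (Fin 3) ℂ] (MvPolynomial (Fin 3) ℂ ⧸ I)) →ₗ[ℂ]
      ({d // d ∈ D.toFinset} → ℂ) where
  toFun Φ d := coord hI d.1.2 (value hI Φ d.1.1)
  map_add' Φ Ψ := by
    ext d
    by_cases h : σ d.1.1 <;> simp [value, h]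
  map_smul' c Φ := by
    ext d
    by_cases h : σ d.1.1 <;> simp [value, h]

theorem finite_hom (hI : HasStandard I σ) {D : List (Exponent × Exponent)}
    (h : Function.Injective (evaluation hI D)) :
    Module.Finite ℂ (↥I →ₗ[MvPolynomial (Fin 3) ℂ] (MvPolynomial (Fin 3) ℂ ⧸ I)) :=
  Module.Finite.of_injective _ h

theorem tangentDim_le_length (hI : HasStandard I σ) {D : List (Exponent × Exponent)}
    (h : Function.Injective (evaluation hI D)) : tangentDim I ≤ D.length := by
  refine (LinearMap.finrank_le_finrank_of_injective h).trans ?_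
  rw [Module.finrank_fintype_fun_eq_card, Fintype.card_coe]
  exact D.toFinset_card_le

/-- The `ℂ`-linear map sending `x^m` to the sum of the `x^s` with `(m, s)` in `K`. -/
noncomputable def transfer (I : Ideal (MvPolynomial (Fin 3) ℂ))
    (K : Finset (Exponent × Exponent)) :
    MvPolynomial (Fin 3) ℂ →ₗ[ℂ] (MvPolynomial (Fin 3) ℂ ⧸ I) :=
  ∑ p ∈ K, (lcoeff ℂ (toFinsupp p.1)).smulRight (Ideal.Quotient.mk I (mon p.2))

theorem coord_transfer (hI : HasStandard I σ) (K : Finset (Exponent × Exponent)) {t : Exponent}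
    (ht : σ t) (f : MvPolynomial (Fin 3) ℂ) :
    coord hI t (transfer I K f) = 
      ∑ p ∈ K with p.2 = t, coeff (toFinsupp p.1) f := by
  simp only [transfer, LinearMap.sum_apply, LinearMap.smulRight_apply, map_sum, map_smul,
    coord_mk hI ht, coeff_mon, lcoeff_apply, smul_eq_mul, mul_ite, mul_one, mul_zero,
    Finset.sum_filter]

/-- The exponents of the three variables. -/
def units : List Exponent := [(1, 0, 0), (0, 1, 0), (0, 0, 1)]

/-- Pairs `(m, s)` are stable if moving both exponents by a variable leads out of `K` only where
this imposes no condition on a homomorphism supported on `K`. -/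
def IsStable (σ : Exponent → Prop) (K : Finset (Exponent × Exponent)) : Prop :=
  ∀ p ∈ K, ∀ u ∈ units, (σ (p.2 + u) → (p.1 + u, p.2 + u) ∈ K) ∧
    (u ≤ p.1 → ¬ σ (p.1 - u) → u ≤ p.2 ∧ (p.1 - u, p.2 - u) ∈ K)

theorem transfer_mon_mul (hI : HasStandard I σ) {K : Finset (Exponent × Exponent)}
    (hK : IsStable σ K) {u : Exponent} (hu : u ∈ units) {f : MvPolynomial (Fin 3) ℂ} (hf : f ∈ I) :
    transfer I K (mon u * f) = mon u • transfer I K f := by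
  rw [← sub_eq_zero]
  refine eq_zero_of_coord hI fun t ht => ?_
  rw [map_sub, sub_eq_zero, coord_mon_smul hI ht, coord_transfer hI K ht]
  have hzero : ∀ m, coeff (toFinsupp m) f ≠ 0 → ¬ σ m := fun m h hm => h ((hI f).1 hf m hm)
  simp only [coeff_mon_mul]
  split_ifs with hut
  · rw [coord_transfer hI K (hI.of_le ht tsub_le_self)]
    refine Finset.sum_bij_ne_zero (fun p _ _ => (p.1 - u, p.2 - u)) ?_ ?_ ?_ ?_
    · intro p hp hne
      obtain ⟨hpK, rfl⟩ := Finset.mem_filter.1 hp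
      obtain ⟨hle, hne⟩ := ite_ne_right_iff.1 hne
      exact Finset.mem_filter.2 ⟨((hK p hpK u hu).2 hle (hzero _ hne)).2, rfl⟩
    · intro p hp hne q hq hne' h
      have hp2 := (Finset.mem_filter.1 hp).2
      have hq2 := (Finset.mem_filter.1 hq).2
      obtain ⟨hle, -⟩ := ite_ne_right_iff.1 hne
      obtain ⟨hle', -⟩ := ite_ne_right_iff.1 hne'
      have h1 := congrArg (· + u) (congrArg Prod.fst h)
      simp only [tsub_add_cancel_of_le hle, tsub_add_cancel_of_le hle'] at h1
      exact Prod.ext h1 (hp2.trans hq2.symm)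
    · intro p hp hne
      obtain ⟨hpK, hp2⟩ := Finset.mem_filter.1 hp
      have e : p.2 + u = t := by rw [hp2, tsub_add_cancel_of_le hut]
      refine ⟨(p.1 + u, p.2 + u), Finset.mem_filter.2 ⟨(hK p hpK u hu).1 (e ▸ ht), e⟩, ?_, ?_⟩
      · simpa using hne
      · simp
    · intro p hp hne
      rw [if_pos (ite_ne_right_iff.1 hne).1]
  · refine Finset.sum_eq_zero fun p hp => ?_
    obtain ⟨hpK, rfl⟩ := Finset.mem_filter.1 hp
    by_contra hne
    obtain ⟨hle, hne⟩ := ite_ne_right_iff.1 hne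
    exact hut ((hK p hpK u hu).2 hle (hzero _ hne)).1

theorem X_eq_mon (i : Fin 3) : ∃ u ∈ units, (X i : MvPolynomial (Fin 3) ℂ) = mon u := by
  have h : ∀ u : Exponent, Finsupp.single i 1 = toFinsupp u →
      (X i : MvPolynomial (Fin 3) ℂ) = mon u := fun u hu => by rw [mon, ← hu, X]
  fin_cases i
  · exact ⟨(1, 0, 0), by simp [units], h _ (by ext j; fin_cases j <;> simp [toFinsupp])⟩
  · exact ⟨(0, 1, 0), by simp [units], h _ (by ext j; fin_cases j <;> simp [toFinsupp])⟩
  · exact ⟨(0, 0, 1), by simp [units], h _ (by ext j; fin_cases j <;> simp [toFinsupp])⟩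

/-- The homomorphism supported on a stable set of pairs. -/
noncomputable def transferHom (hI : HasStandard I σ) {K : Finset (Exponent × Exponent)}
    (hK : IsStable σ K) : ↥I →ₗ[MvPolynomial (Fin 3) ℂ] (MvPolynomial (Fin 3) ℂ ⧸ I) where
  toFun f := transfer I K f
  map_add' f g := by simp
  map_smul' p f := by
    simp only [RingHom.id_apply, Submodule.coe_smul, smul_eq_mul]
    obtain ⟨f, hf⟩ := f
    simp only
    induction p using MvPolynomial.induction_on generalizing f with
    | C a => rw [← smul_eq_C_mul, map_smul, ← algebraMap_eq, algebraMap_smul]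
    | add p q hp hq => rw [add_mul, map_add, add_smul, hp f hf, hq f hf]
    | mul_X p i hp =>
      obtain ⟨u, hu, e⟩ := X_eq_mon i
      rw [e, mul_assoc, hp _ (I.mul_mem_left _ hf), transfer_mon_mul hI hK hu hf, mul_smul]

theorem coord_transferHom (hI : HasStandard I σ) {K : Finset (Exponent × Exponent)}
    (hK : IsStable σ K) {m s : Exponent} (hm : ¬ σ m) (hs : σ s) :
    coord hI s (value hI (transferHom hI hK) m) = if (m, s) ∈ K then 1 else 0 := by
  rw [value_eq _ hI hm]
  change coord hI s (transfer I K (mon m)) = _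
  rw [coord_transfer hI K hs]
  simp only [coeff_mon, Finset.sum_filter, ← ite_and]
  have (p : Exponent × Exponent) : (p.2 = s ∧ m = p.1) ↔ (m, s) = p := by
    rw [@Prod.ext_iff _ _ (m, s) p, and_comm, eq_comm (a := s)]
  simp only [this, Finset.sum_ite_eq]

theorem card_le_tangentDim (hI : HasStandard I σ) {D : List (Exponent × Exponent)}
    (hD : ∀ d ∈ D, ¬ σ d.1 ∧ σ d.2) {K : Exponent × Exponent → Finset (Exponent × Exponent)}
    (hK : ∀ d ∈ D, IsStable σ (K d)) (hKD : ∀ d ∈ D, ∀ d' ∈ D, d' ∈ K d ↔ d' = d)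
    (hfin : Module.Finite ℂ (↥I →ₗ[MvPolynomial (Fin 3) ℂ] (MvPolynomial (Fin 3) ℂ ⧸ I))) :
    D.toFinset.card ≤ tangentDim I := by
  classical
  have hsurj : Function.Surjective (evaluation hI D) := by
    rw [← LinearMap.range_eq_top, eq_top_iff, ← (Pi.basisFun ℂ _).span_eq, Submodule.span_le]
    rintro _ ⟨d, rfl⟩
    have hd := List.mem_toFinset.1 d.2
    refine ⟨transferHom hI (hK _ hd), ?_⟩
    ext d'
    have hd' := List.mem_toFinset.1 d'.2
    have := coord_transferHom hI (hK _ hd) (hD _ hd').1 (hD _ hd').2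
    refine this.trans ?_
    rw [Pi.basisFun_apply, Pi.single_apply]
    exact if_congr ((hKD _ hd _ hd').trans Subtype.ext_iff.symm) rfl rfl
  have := LinearMap.finrank_le_finrank_of_surjective hsurj
  rwa [Module.finrank_fintype_fun_eq_card, Fintype.card_coe] at this

/-- Entry `b` of row `a` of the table `L`, zero outside of it. -/
def height (L : List (List ℕ)) (a b : ℕ) : ℕ := (L.getD a []).getD b 0

/-- Membership in the set of exponents below the table `L`. -/
def isStd (L : List (List ℕ)) (m : Exponent) : Bool := Nat.blt m.2.2 (height L m.1 m.2.1)

theorem isStd_iff {L : List (List ℕ)} {m : Exponent} :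
    isStd L m ↔ m.2.2 < height L m.1 m.2.1 := by
  rw [isStd, Nat.blt_eq]

/-- Componentwise comparison of exponents, in a form which is fast to evaluate. -/
def below (s m : Exponent) : Bool :=
  Nat.ble s.1 m.1 && Nat.ble s.2.1 m.2.1 && Nat.ble s.2.2 m.2.2

theorem below_iff {s m : Exponent} : below s m ↔ s ≤ m := by
  simp [below, le_iff, and_assoc]

/-- The table `L` is supported on three rows and five columns. -/
def InBox (L : List (List ℕ)) : Prop := L.length ≤ 3 ∧ ∀ p ∈ L, p.length ≤ 5

theorem InBox.height_eq_zero {L : List (List ℕ)} (hL : InBox L) {a b : ℕ} (h : 3 ≤ a ∨ 5 ≤ b) :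
    height L a b = 0 := by
  rw [height]
  by_cases ha : a < L.length
  · rw [List.getD_eq_getElem _ _ ha]
    refine List.getD_eq_default _ _ ((hL.2 _ (List.getElem_mem ha)).trans ?_)
    have := hL.1
    omega
  · rw [List.getD_eq_default _ _ (not_lt.1 ha)]
    simp

/-- The minimal generators of the monomial ideal with standard exponents `L`. -/
def gens (L : List (List ℕ)) : List Exponent :=
  (List.range 4).flatMap fun a => (List.range 6).flatMap fun b =>
    if (a = 0 ∨ height L a b < height L (a - 1) b) ∧
      (b = 0 ∨ height L a b < height L a (b - 1)) then [(a, b, height L a b)] else []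

/-- The list of standard exponents. -/
def stds (L : List (List ℕ)) : List Exponent :=
  (List.range 3).flatMap fun a => (List.range 5).flatMap fun b =>
    (List.range (height L a b)).map fun c => (a, b, c)

theorem InBox.mem_stds {L : List (List ℕ)} (hL : InBox L) {m : Exponent} :
    m ∈ stds L ↔ isStd L m := by
  obtain ⟨a, b, c⟩ := m
  simp only [stds, List.mem_flatMap, List.mem_range, List.mem_map, Prod.mk.injEq, isStd_iff]
  constructor
  · rintro ⟨a, -, b, -, c, h, rfl, rfl, rfl⟩
    exact h
  · intro h
    have hab : ¬ (3 ≤ a ∨ 5 ≤ b) := fun hab => by simp [hL.height_eq_zero hab] at h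
    exact ⟨a, by omega, b, by omega, c, h, rfl, rfl, rfl⟩

theorem mem_gens {L : List (List ℕ)} {m : Exponent} : m ∈ gens L ↔ m.1 < 4 ∧ m.2.1 < 6 ∧
    m.2.2 = height L m.1 m.2.1 ∧ (m.1 = 0 ∨ height L m.1 m.2.1 < height L (m.1 - 1) m.2.1) ∧
    (m.2.1 = 0 ∨ height L m.1 m.2.1 < height L m.1 (m.2.1 - 1)) := by
  obtain ⟨a, b, c⟩ := m
  simp only [gens, List.mem_flatMap, List.mem_range, List.mem_ite_nil_right, List.mem_singleton,
    Prod.mk.injEq]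
  constructor
  · rintro ⟨a, ha, b, hb, h, rfl, rfl, rfl⟩
    exact ⟨ha, hb, rfl, h⟩
  · rintro ⟨ha, hb, hc, h⟩
    exact ⟨a, ha, b, hb, h, rfl, rfl, hc⟩

theorem not_isStd_of_mem_gens {L : List (List ℕ)} {m : Exponent} (hm : m ∈ gens L) :
    ¬ isStd L m := by
  rw [isStd_iff, ← (mem_gens.1 hm).2.2.1]
  exact lt_irrefl _

theorem InBox.exists_gens_le {L : List (List ℕ)} (hL : InBox L) {m : Exponent}
    (hm : ¬ isStd L m) : ∃ g ∈ gens L, g ≤ m := by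
  obtain ⟨a, b, c⟩ := m
  induction hn : a + b using Nat.strong_induction_on generalizing a b with
  | _ n ih =>
  subst hn
  rw [isStd_iff, not_lt] at hm
  simp only at hm
  by_cases ha : a = 0 ∨ height L a b < height L (a - 1) b
  · by_cases hb : b = 0 ∨ height L a b < height L a (b - 1)
    · refine ⟨(a, b, height L a b), mem_gens.2 ⟨?_, ?_, rfl, ha, hb⟩, ?_⟩
      · by_contra h
        simp only at h
        rw [hL.height_eq_zero (a := a - 1) (by omega)] at ha
        omega
      · by_contra h
        simp only at h
        rw [hL.height_eq_zero (b := b - 1) (by omega)] at hb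
        omega
      · simpa [le_iff] using hm
    · push Not at hb
      obtain ⟨g, hg, hle⟩ := ih (a + (b - 1)) (by omega) a (b - 1)
        (by rw [isStd_iff, not_lt]; exact hb.2.trans hm) rfl
      exact ⟨g, hg, hle.trans (by simp)⟩
  · push Not at ha
    obtain ⟨g, hg, hle⟩ := ih (a - 1 + b) (by omega) (a - 1) b
      (by rw [isStd_iff, not_lt]; exact ha.2.trans hm) rfl
    exact ⟨g, hg, hle.trans (by simp)⟩

/-- The coefficient of `x^s` in the value at `x^g` is determined, through at most `n` relations,
by the values at the monomials in `done`. -/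
def redundant (L : List (List ℕ)) (G done : List Exponent) : ℕ → Exponent → Exponent → Bool
  | 0, _, _ => false
  | n + 1, g, s => G.any fun h =>
      isStd L (s + (h - g)) &&
        (!below g (s + h) || done.contains h || redundant L G done n h (s + h - g))

/-- The coefficients of the values at the monomials in a list that are not determined by
coefficients of the values at previous monomials. -/
def irredundant (n : ℕ) (L : List (List ℕ)) (G : List Exponent) :
    List Exponent → List Exponent → List (Exponent × Exponent)
  | _, [] => []
  | done, g :: todo =>
    ((stds L).filter fun s => !redundant L G done n g s).map (fun s => (g, s)) ++
      irredundant n L G (g :: done) todo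

/-- Coordinates that suffice to determine a homomorphism, obtained with search depth `n`. -/
def free (n : ℕ) (L : List (List ℕ)) : List (Exponent × Exponent) :=
  irredundant n L (gens L) [] (gens L)

section Bound

variable {L : List (List ℕ)}

theorem coord_eq_zero_of_redundant (hI : HasStandard I (fun m => isStd L m))
    {G done : List Exponent}
    (hG : ∀ g ∈ G, ¬ isStd L g) (hdone : ∀ g ∈ done, value hI Φ g = 0) (n : ℕ) {g s : Exponent}
    (hg : ¬ isStd L g) (h : redundant L G done n g s) :
    coord hI s (value hI Φ g) = 0 := by
  induction n generalizing g s with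
  | zero => simp [redundant] at h
  | succ n ih =>
    simp only [redundant, List.any_eq_true, Bool.and_eq_true, Bool.or_eq_true,
      Bool.not_eq_eq_eq_not, Bool.not_true, List.contains_iff_mem] at h
    obtain ⟨h, hh, hs, hc⟩ := h
    rw [coord_value_eq Φ hI hg (hG h hh) hs]
    split_ifs with hle
    · rcases hc with (hc | hc) | hc
      · rw [below_iff.2 hle] at hc
        contradiction
      · rw [hdone h hc, map_zero]
      · exact ih (hG h hh) hc
    · rfl

theorem value_eq_zero_of_irredundant (hL : InBox L) (hI : HasStandard I (fun m => isStd L m))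
    {n : ℕ} {G : List Exponent} (hG : ∀ g ∈ G, ¬ isStd L g) (done todo : List Exponent)
    (htodo : ∀ g ∈ todo, ¬ isStd L g) (hdone : ∀ g ∈ done, value hI Φ g = 0)
    (h : ∀ d ∈ irredundant n L G done todo, coord hI d.2 (value hI Φ d.1) = 0) :
    ∀ g ∈ todo, value hI Φ g = 0 := by
  induction todo generalizing done with
  | nil => simp
  | cons g todo ih =>
    simp only [irredundant, List.mem_append, List.mem_map, List.mem_filter] at h
    have hg : value hI Φ g = 0 := by
      refine eq_zero_of_coord hI fun s hs => ?_
      by_cases hr : redundant L G done n g s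
      · exact coord_eq_zero_of_redundant Φ hI hG hdone n (htodo g List.mem_cons_self) hr
      · exact h (g, s) (Or.inl ⟨s, ⟨hL.mem_stds.2 hs, by simpa using hr⟩, rfl⟩)
    have := ih (g :: done) (fun k hk => htodo k (List.mem_cons_of_mem _ hk))
      (by simpa [hg] using hdone) (fun d hd => h d (Or.inr hd))
    simpa [hg] using this

theorem evaluation_free_injective (hL : InBox L) (hI : HasStandard I (fun m => isStd L m))
    (n : ℕ) : Function.Injective (evaluation hI (free n L)) := by
  rw [← LinearMap.ker_eq_bot, LinearMap.ker_eq_bot']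
  intro Φ hΦ
  refine eq_zero_of_value Φ hI (G := gens L) (fun m hm => ?_) ?_
  · obtain ⟨g, hg, hle⟩ := hL.exists_gens_le hm
    exact ⟨g, hg, not_isStd_of_mem_gens hg, hle⟩
  · refine value_eq_zero_of_irredundant Φ hL hI (n := n) (G := gens L)
      (fun _ => not_isStd_of_mem_gens) [] _ (fun _ => not_isStd_of_mem_gens) (by simp) ?_
    intro d hd
    exact congrFun hΦ ⟨d, List.mem_toFinset.2 hd⟩

theorem tangentDim_le_free (hL : InBox L) (hI : HasStandard I (fun m => isStd L m)) (n : ℕ) :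
    tangentDim I ≤ (free n L).length :=
  tangentDim_le_length hI (evaluation_free_injective hL hI n)

end Bound

/-- The lists with entries at most `p - 1` and those of `B`, of sum at most `n`, that strictly
decrease until they vanish. -/
def rows : List ℕ → ℕ → ℕ → List (List ℕ)
  | [], _, _ => [[]]
  | b :: B, p, n => (List.range (min b (min (p - 1) n) + 1)).flatMap fun v =>
      (rows B v (n - v)).map (v :: ·)

theorem cons_mem_rows {b p n v : ℕ} {B l : List ℕ} (hb : v ≤ b) (hp : v ≤ p - 1) (hn : v ≤ n)
    (hl : l ∈ rows B v (n - v)) : v :: l ∈ rows (b :: B) p n := by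
  simp only [rows, List.mem_flatMap, List.mem_range, List.mem_map]
  exact ⟨v, by omega, l, hl, rfl⟩

/-- The tables of the Borel-fixed ideals of colength `15` containing `x^3`. -/
def diagrams : List (List (List ℕ)) :=
  (rows [15, 15, 15, 15, 15] 16 15).flatMap fun p =>
    (rows p.tail 16 (15 - p.sum)).flatMap fun q =>
      ((rows q.tail 16 (15 - p.sum - q.sum)).filter
        fun r => p.sum + q.sum + r.sum == 15).map fun r => [p, q, r]

theorem mem_diagrams (h : ℕ → ℕ → ℕ) (hdec : ∀ a b, h a (b + 1) ≤ h a b - 1)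
    (hshift : ∀ a b, h (a + 1) b ≤ h a (b + 1))
    (hsum : h 0 0 + h 0 1 + h 0 2 + h 0 3 + h 0 4 + (h 1 0 + h 1 1 + h 1 2 + h 1 3) +
      (h 2 0 + h 2 1 + h 2 2) = 15) :
    [[h 0 0, h 0 1, h 0 2, h 0 3, h 0 4], [h 1 0, h 1 1, h 1 2, h 1 3], [h 2 0, h 2 1, h 2 2]] ∈
      diagrams := by
  simp only [diagrams, List.mem_flatMap, List.mem_map, List.mem_filter]
  refine ⟨[h 0 0, h 0 1, h 0 2, h 0 3, h 0 4], ?_, [h 1 0, h 1 1, h 1 2, h 1 3], ?_,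
    [h 2 0, h 2 1, h 2 2], ⟨?_, ?_⟩, rfl⟩
  · refine cons_mem_rows ?_ ?_ ?_ (cons_mem_rows ?_ (hdec 0 0) ?_ (cons_mem_rows ?_ (hdec 0 1) ?_
      (cons_mem_rows ?_ (hdec 0 2) ?_ (cons_mem_rows ?_ (hdec 0 3) ?_ (by simp [rows]))))) <;> omega
  · refine cons_mem_rows (hshift 0 0) ?_ ?_ (cons_mem_rows (hshift 0 1) (hdec 1 0) ?_
      (cons_mem_rows (hshift 0 2) (hdec 1 1) ?_
      (cons_mem_rows (hshift 0 3) (hdec 1 2) ?_ (by simp [rows])))) <;>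
    (try simp only [List.sum_cons, List.sum_nil]) <;> omega
  · refine cons_mem_rows (hshift 1 0) ?_ ?_ (cons_mem_rows (hshift 1 1) (hdec 2 0) ?_
      (cons_mem_rows (hshift 1 2) (hdec 2 1) ?_ (by simp [rows]))) <;>
    (try simp only [List.sum_cons, List.sum_nil]) <;> omega
  · simp only [List.sum_cons, List.sum_nil, beq_iff_eq]
    omega

section Classification

theorem _root_.IsBorelFixed.of_std (hI : IsBorelFixed I) {a b c : ℕ} :
    (mon (a + 1, b, c) ∉ I → mon (a, b + 1, c) ∉ I) ∧
    (mon (a, b + 1, c) ∉ I → mon (a, b, c + 1) ∉ I) := by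
  constructor
  · refine mt fun h => ?_
    have := hI _ h 0 1 (by decide) (by simp [toFinsupp])
    have e : toFinsupp (a, b + 1, c) + Finsupp.single 0 1 - Finsupp.single 1 1 =
        toFinsupp (a + 1, b, c) := by
      ext i; fin_cases i <;> simp [toFinsupp, Matrix.vecHead, Matrix.vecTail]
    rwa [e] at this
  · refine mt fun h => ?_
    have := hI _ h 1 2 (by decide) (by simp [toFinsupp])
    have e : toFinsupp (a, b, c + 1) + Finsupp.single 1 1 - Finsupp.single 2 1 =
        toFinsupp (a, b + 1, c) := by
      ext i; fin_cases i <;> simp [toFinsupp, Matrix.vecHead, Matrix.vecTail]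
    rwa [e] at this

theorem _root_.IsBorelFixed.of_std_add (hI : IsBorelFixed I) {a b c : ℕ} (k : ℕ) :
    (mon (a + k, b, c) ∉ I → mon (a, b + k, c) ∉ I) ∧
    (mon (a, b + k, c) ∉ I → mon (a, b, c + k) ∉ I) := by
  induction k generalizing a b c with
  | zero => simp
  | succ k ih =>
    constructor
    · intro h
      rw [← add_assoc, add_right_comm] at h
      have := hI.of_std.1 (ih.1 h)
      rwa [add_assoc] at this
    · intro h
      rw [← add_assoc, add_right_comm] at h
      have := hI.of_std.2 (ih.2 h)
      rwa [add_assoc] at this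

theorem exists_height (hI : HasStandard I σ) (hfin : {m | σ m}.Finite) :
    ∃ h : ℕ → ℕ → ℕ, ∀ a b c, σ (a, b, c) ↔ c < h a b := by
  classical
  have hex : ∀ a b, ∃ c, ¬ σ (a, b, c) := by
    intro a b
    by_contra! hc
    exact Set.infinite_of_injective_forall_mem (f := fun c : ℕ => ((a, b, c) : Exponent))
      (fun _ _ h => by simpa using h) hc hfin
  refine ⟨fun a b => Nat.find (hex a b), fun a b c => ?_⟩
  rw [Nat.lt_find_iff]
  exact ⟨fun h k hk => not_not.2 (hI.of_le h (by simp [hk])), fun h => not_not.1 (h c le_rfl)⟩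

theorem card_std_eq_sum {h : ℕ → ℕ → ℕ} {k l : ℕ} (hh : ∀ a b c, σ (a, b, c) ↔ c < h a b)
    (hk : ∀ a b, k ≤ a ∨ l ≤ b → h a b = 0) :
    Nat.card {m // σ m} = ∑ a ∈ Finset.range k, ∑ b ∈ Finset.range l, h a b := by
  classical
  let F : Finset Exponent := ((Finset.range k ×ˢ Finset.range l).sigma
    fun ab => Finset.range (h ab.1 ab.2)).image fun x => (x.1.1, x.1.2, x.2)
  have hF : ∀ m, m ∈ F ↔ σ m := by
    rintro ⟨a, b, c⟩
    simp only [F, Finset.mem_image, Finset.mem_sigma, Finset.mem_product, Finset.mem_range,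
      Prod.mk.injEq, hh]
    constructor
    · rintro ⟨⟨⟨a, b⟩, c⟩, ⟨-, h⟩, rfl, rfl, rfl⟩
      exact h
    · intro hc
      have hab : ¬ (k ≤ a ∨ l ≤ b) := fun hab => by simp [hk a b hab] at hc
      exact ⟨⟨⟨a, b⟩, c⟩, ⟨by simp; omega, hc⟩, rfl, rfl, rfl⟩
  have hinj : Function.Injective
      fun x : (_ : ℕ × ℕ) × ℕ => ((x.1.1, x.1.2, x.2) : Exponent) := by
    rintro ⟨⟨a, b⟩, c⟩ ⟨⟨a', b'⟩, c'⟩ h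
    simp only [Prod.mk.injEq] at h
    obtain ⟨rfl, rfl, rfl⟩ := h
    rfl
  rw [← Finset.sum_product', Nat.card_congr (Equiv.subtypeEquivRight fun m => (hF m).symm)]
  rw [Nat.card_eq_fintype_card, Fintype.card_coe, Finset.card_image_of_injective _ hinj,
    Finset.card_sigma]
  simp only [Finset.card_range]

theorem _root_.IsBorelFixed.y_pow_five_mem (hI : IsBorelFixed I) (hm : HasStandard I σ)
    (hcard : Nat.card {m // σ m} = 15) : ¬ σ (0, 5, 0) := by
  intro h5
  have hfin : Finite {m // σ m} := Nat.finite_of_card_ne_zero (by omega)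
  let F : Finset Exponent :=
    ((Finset.range 6 ×ˢ Finset.range 6).filter fun x => x.1 + x.2 ≤ 5).image fun x => (0, x.1, x.2)
  have hF : ∀ m : {m // m ∈ F}, σ m := by
    rintro ⟨m, hmF⟩
    simp only [F, Finset.mem_image, Finset.mem_filter] at hmF
    obtain ⟨⟨b, c⟩, ⟨-, hbc⟩, rfl⟩ := hmF
    simp only at hbc
    have h5' : mon (0, b + (5 - b), 0) ∉ I := by
      rw [hm.mon_mem, not_not]
      convert h5 using 3
      omega
    have := (hI.of_std_add _).2 h5'
    rw [hm.mon_mem, not_not] at this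
    exact hm.of_le this (by simp; omega)
  have := Nat.card_le_card_of_injective (fun m : {m // m ∈ F} => (⟨m, hF m⟩ : {m // σ m}))
    (fun m n h => Subtype.ext (congrArg (fun x : {m // σ m} => x.1) h))
  rw [hcard, Nat.card_eq_fintype_card, Fintype.card_coe] at this
  revert this
  decide

/-- A Borel-fixed ideal of colength `15` containing `x^3` is given by one of the `diagrams`. -/
theorem exists_mem_diagrams (hmon : IsMonomialIdeal I) (hI : IsBorelFixed I)
    (hrank : Module.finrank ℂ (MvPolynomial (Fin 3) ℂ ⧸ I) = 15) (hx : mon (3, 0, 0) ∈ I) :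
    ∃ L ∈ diagrams, HasStandard I (fun m => isStd L m) := by
  have hm := hmon.hasStandard
  have hcard := (finrank_quotient hm).symm.trans hrank
  have hfin : {m | mon m ∉ I}.Finite :=
    Set.finite_coe_iff.1 (Nat.finite_of_card_ne_zero (α := {m // mon m ∉ I}) (by omega))
  obtain ⟨h, hh⟩ := exists_height hm hfin
  have hx' : ∀ a b, 3 ≤ a → h a b = 0 := by
    intro a b ha
    by_contra h0
    exact hm.of_le ((hh a b 0).2 (by omega)) (m := (3, 0, 0)) (by simp [ha]) hx
  have hy : ∀ a b, 5 ≤ a + b → h a b = 0 := by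
    intro a b hab
    by_contra h0
    have h1 : mon (0 + a, b, 0) ∉ I := by
      rw [zero_add]
      exact (hh a b 0).2 (by omega)
    refine hI.y_pow_five_mem hm hcard (hm.of_le ((hI.of_std_add a).1 h1) ?_)
    simp
    omega
  have hdec : ∀ a b, h a (b + 1) ≤ h a b - 1 := by
    intro a b
    by_contra! hlt
    have := (hh a b _).1 (hI.of_std.2 ((hh a (b + 1) (h a b - 1)).2 hlt))
    omega
  have hshift : ∀ a b, h (a + 1) b ≤ h a (b + 1) := by
    intro a b
    by_contra! hlt
    exact lt_irrefl _ ((hh a (b + 1) _).1 (hI.of_std.1 ((hh (a + 1) b _).2 hlt)))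
  have hsum := card_std_eq_sum (σ := fun m => mon m ∉ I) (k := 3) (l := 5) hh
    fun a b hab => hab.elim (hx' a b) fun hb => hy a b (by omega)
  rw [hcard] at hsum
  simp only [Finset.sum_range_succ, Finset.sum_range_zero, hy 1 4 (by omega), hy 2 3 (by omega),
    hy 2 4 (by omega)] at hsum
  refine ⟨_, mem_diagrams h hdec hshift (by omega), ?_⟩
  convert hm using 2 with m
  obtain ⟨a, b, c⟩ := m
  rw [isStd_iff]
  refine Iff.trans ?_ (hh a b c).symm
  have : height [[h 0 0, h 0 1, h 0 2, h 0 3, h 0 4], [h 1 0, h 1 1, h 1 2, h 1 3],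
      [h 2 0, h 2 1, h 2 2]] a b = h a b := by
    match a, b with
    | 0, 0 | 0, 1 | 0, 2 | 0, 3 | 0, 4 | 1, 0 | 1, 1 | 1, 2 | 1, 3 | 2, 0 | 2, 1 | 2, 2 => rfl
    | 0, b + 5 => exact (hy 0 (b + 5) (by omega)).symm
    | 1, b + 4 => exact (hy 1 (b + 4) (by omega)).symm
    | 2, b + 3 => exact (hy 2 (b + 3) (by omega)).symm
    | a + 3, b => exact (hx' (a + 3) b (by omega)).symm
  rw [this]

end Classification

/-- A table with the properties that make its exponents the standard ones of a Borel-fixed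
ideal. -/
def IsBorelTable (L : List (List ℕ)) : Prop :=
  InBox L ∧ (∀ s ∈ stds L, ∀ g ∈ gens L, ¬ below g s) ∧
    ∀ s ∈ stds L, (0 < s.1 → isStd L (s.1 - 1, s.2.1 + 1, s.2.2)) ∧
      (0 < s.2.1 → isStd L (s.1, s.2.1 - 1, s.2.2 + 1)) ∧
      (0 < s.1 → isStd L (s.1 - 1, s.2.1, s.2.2 + 1))

instance (L : List (List ℕ)) : Decidable (IsBorelTable L) := by
  unfold IsBorelTable InBox
  infer_instance

/-- The ideal generated by `gens L`. -/
noncomputable def tableIdeal (L : List (List ℕ)) : Ideal (MvPolynomial (Fin 3) ℂ) :=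
  Ideal.span ((fun d => monomial d (1 : ℂ)) '' {d | ofFinsupp d ∈ gens L})

theorem IsBorelTable.hasStandard {L : List (List ℕ)} (hL : IsBorelTable L) :
    HasStandard (tableIdeal L) (fun m => isStd L m) := by
  intro p
  rw [tableIdeal, mem_ideal_span_monomial_image]
  constructor
  · intro h m hm
    by_contra hne
    obtain ⟨g, hg, hle⟩ := h _ (mem_support_iff.2 hne)
    rw [← toFinsupp_ofFinsupp g, toFinsupp_le] at hle
    exact hL.2.1 m (hL.1.mem_stds.2 hm) _ hg (below_iff.2 hle)
  · intro h d hd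
    have hd' : ¬ isStd L (ofFinsupp d) := fun hs =>
      mem_support_iff.1 hd (by simpa using h _ hs)
    obtain ⟨g, hg, hle⟩ := hL.1.exists_gens_le hd'
    exact ⟨toFinsupp g, hg, by rwa [← toFinsupp_le, toFinsupp_ofFinsupp] at hle⟩

theorem IsBorelTable.isBorelFixed {L : List (List ℕ)} (hL : IsBorelTable L) :
    IsBorelFixed (tableIdeal L) := by
  have hmem : ∀ d : Fin 3 →₀ ℕ, monomial d (1 : ℂ) ∈ tableIdeal L ↔ ¬ isStd L (ofFinsupp d) := by
    intro d
    rw [← hL.hasStandard.mon_mem, mon, toFinsupp_ofFinsupp]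
  intro d hd i j hij hj
  rw [hmem] at hd ⊢
  refine mt (fun h => ?_) hd
  obtain ⟨h1, h2, h3⟩ := hL.2.2 _ (hL.1.mem_stds.2 h)
  have hcases : ∀ i j : Fin 3, i < j →
      (i = 0 ∧ j = 1) ∨ (i = 1 ∧ j = 2) ∨ (i = 0 ∧ j = 2) := by
    decide
  rcases hcases i j hij with ⟨rfl, rfl⟩ | ⟨rfl, rfl⟩ | ⟨rfl, rfl⟩
  · simpa [ofFinsupp, Nat.sub_add_cancel hj] using h1
  · simpa [ofFinsupp, Nat.sub_add_cancel hj] using h2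
  · simpa [ofFinsupp, Nat.sub_add_cancel hj] using h3

theorem IsBorelTable.finrank_quotient {L : List (List ℕ)} (hL : IsBorelTable L) :
    Module.finrank ℂ (MvPolynomial (Fin 3) ℂ ⧸ tableIdeal L) = (stds L).toFinset.card := by
  rw [Staircase.finrank_quotient hL.hasStandard, ← Fintype.card_coe, ← Nat.card_eq_fintype_card]
  exact Nat.card_congr (Equiv.subtypeEquivRight fun m => by
    rw [List.mem_toFinset, hL.1.mem_stds])

/-- The pairs linked to a pair `(m, s)` by multiplication or division by a variable. -/
def moves (L : List (List ℕ)) (p : Exponent × Exponent) : List (Exponent × Exponent) :=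
  units.flatMap fun u =>
    (if isStd L (p.2 + u) then [(p.1 + u, p.2 + u)] else []) ++
      (if below u p.1 && below u p.2 && !isStd L (p.1 - u) then [(p.1 - u, p.2 - u)] else [])

/-- Graph search for `n` steps along `moves`. -/
def explore (L : List (List ℕ)) :
    ℕ → List (Exponent × Exponent) → List (Exponent × Exponent) → List (Exponent × Exponent)
  | 0, _, seen => seen
  | _ + 1, [], seen => seen
  | n + 1, p :: todo, seen =>
    if seen.contains p then explore L n todo seen else explore L n (moves L p ++ todo) (p :: seen)

/-- The pairs linked to `d`. -/
def component (L : List (List ℕ)) (d : Exponent × Exponent) : List (Exponent × Exponent) :=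
  explore L 200 [d] []

/-- The list `K` of pairs is closed under multiplication and division by a variable. -/
def IsClosedList (L : List (List ℕ)) (K : List (Exponent × Exponent)) : Prop :=
  ∀ p ∈ K, (∀ u ∈ units, isStd L (p.2 + u) → (p.1 + u, p.2 + u) ∈ K) ∧
    (∀ u ∈ units, below u p.1 → ¬ isStd L (p.1 - u) → below u p.2 ∧ (p.1 - u, p.2 - u) ∈ K)

set_option synthInstance.maxSize 2000 in
set_option synthInstance.maxHeartbeats 400000 in
instance (L : List (List ℕ)) (K : List (Exponent × Exponent)) : Decidable (IsClosedList L K) :=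
  List.decidableBAll _ _

/-- The pairs in `D` lie in distinct stable components. -/
def IsIndependent (L : List (List ℕ)) (D : List (Exponent × Exponent)) : Prop :=
  ∀ d ∈ D, (¬ isStd L d.1 ∧ isStd L d.2) ∧ IsClosedList L (component L d) ∧
    ∀ d' ∈ D, (d' ∈ component L d ↔ d' = d)

instance (L : List (List ℕ)) (D : List (Exponent × Exponent)) : Decidable (IsIndependent L D) :=
  List.decidableBAll _ _

theorem IsBorelTable.card_le_tangentDim {L : List (List ℕ)} (hL : IsBorelTable L)
    {D : List (Exponent × Exponent)} (hD : IsIndependent L D) :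
    D.toFinset.card ≤ tangentDim (tableIdeal L) := by
  refine Staircase.card_le_tangentDim hL.hasStandard (fun d hd => (hD d hd).1)
    (K := fun d => (component L d).toFinset) (fun d hd => ?_) (fun d hd d' hd' => ?_)
    (finite_hom hL.hasStandard (evaluation_free_injective hL.1 hL.hasStandard 1))
  · simpa only [IsStable, IsClosedList, List.mem_toFinset, below_iff, forall_and] using
      (hD d hd).2.1
  · simpa only [List.mem_toFinset] using (hD d hd).2.2 d' hd'

theorem IsBorelTable.isGreatest {L : List (List ℕ)} {m T : ℕ} (hL : IsBorelTable L)
    {D : List (Exponent × Exponent)} (hD : IsIndependent L D) (hT : D.toFinset.card = T)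
    (hcard : (stds L).toFinset.card = 15) (hm : ¬ isStd L (m, 0, 0)) (hm' : isStd L (m - 1, 0, 0))
    (hub : ∀ I : Ideal (MvPolynomial (Fin 3) ℂ), IsMonomialIdeal I → IsBorelFixed I →
      Module.finrank ℂ (MvPolynomial (Fin 3) ℂ ⧸ I) = 15 → mon (m, 0, 0) ∈ I → tangentDim I ≤ T) :
    TmaxEq 15 m T := by
  have hrank := hL.finrank_quotient.trans hcard
  have hx := hL.hasStandard.mon_mem.2 hm
  refine ⟨⟨tableIdeal L, hL.hasStandard.isMonomialIdeal, hL.isBorelFixed, hrank, ?_, ?_, ?_⟩, ?_⟩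
  · rwa [X_zero_pow]
  · rw [X_zero_pow, hL.hasStandard.mon_mem]
    exact not_not.2 hm'
  · exact le_antisymm (hT ▸ hL.card_le_tangentDim hD)
      (hub _ hL.hasStandard.isMonomialIdeal hL.isBorelFixed hrank hx)
  · rintro _ ⟨I, hmon, hI, hr, hx, -, rfl⟩
    rw [X_zero_pow] at hx
    exact hub I hmon hI hr hx

/-- The bound on tangent space dimensions, depending on the power of `x` in the ideal. -/
def bound (L : List (List ℕ)) : ℕ :=
  if height L 2 0 = 0 then if height L 1 0 = 0 then 68 else 69 else 81

set_option maxRecDepth 100000 in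
theorem free_length_le_bound : ∀ L ∈ diagrams,
    InBox L ∧ ∃ n ∈ [1, 2, 3], (free n L).length ≤ bound L := by
  unfold InBox
  decide +kernel

theorem tangentDim_le {I : Ideal (MvPolynomial (Fin 3) ℂ)} (hmon : IsMonomialIdeal I)
    (hI : IsBorelFixed I) (hrank : Module.finrank ℂ (MvPolynomial (Fin 3) ℂ ⧸ I) = 15) {m : ℕ}
    (hm : m ≤ 3) (hx : mon (m, 0, 0) ∈ I) :
    tangentDim I ≤ if m ≤ 2 then if m ≤ 1 then 68 else 69 else 81 := by
  have hx' : ∀ k, m ≤ k → mon (k, 0, 0) ∈ I := by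
    intro k hk
    have : ((k, 0, 0) : Exponent) = (k - m, 0, 0) + (m, 0, 0) := by simp [hk]
    rw [this, mon_add]
    exact I.mul_mem_left _ hx
  obtain ⟨L, hL, hstd⟩ := exists_mem_diagrams hmon hI hrank (hx' 3 hm)
  obtain ⟨hbox, n, -, hn⟩ := free_length_le_bound L hL
  refine (tangentDim_le_free hbox hstd n).trans (hn.trans ?_)
  have h0 : ∀ k, m ≤ k → height L k 0 = 0 := by
    intro k hk
    simpa [isStd_iff] using hstd.mon_mem.1 (hx' k hk)
  have h1 := h0 1
  have h2 := h0 2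
  unfold bound
  split_ifs <;> omega

end Staircase

open Staircase

theorem Tmax_monotonicity_l15 :
    TmaxEq 15 2 69 ∧
    TmaxEq 15 3 81 ∧
    (∀ T1 T2 T3 : ℕ, TmaxEq 15 1 T1 → TmaxEq 15 2 T2 → TmaxEq 15 3 T3 →
      T1 < T2 ∧ T2 < T3) := by
  have h2 : TmaxEq 15 2 69 := by
    refine IsBorelTable.isGreatest (L := [[5, 3, 2, 1], [3, 1]])
      (D := free 3 [[5, 3, 2, 1], [3, 1]]) (by decide +kernel) (by decide +kernel)
      (by decide +kernel) (by decide +kernel) (by decide) (by decide) ?_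
    exact fun I hmon hI hr hx => tangentDim_le hmon hI hr (by decide) hx
  have h3 : TmaxEq 15 3 81 := by
    refine IsBorelTable.isGreatest (L := [[6, 3, 1], [3, 1], [1]])
      (D := free 3 [[6, 3, 1], [3, 1], [1]]) (by decide +kernel) (by decide +kernel)
      (by decide +kernel) (by decide +kernel) (by decide) (by decide) ?_
    exact fun I hmon hI hr hx => tangentDim_le hmon hI hr (by decide) hx
  refine ⟨h2, h3, fun T1 T2 T3 H1 H2 H3 => ?_⟩
  rw [H2.unique h2, H3.unique h3]
  obtain ⟨I, hmon, hI, hr, hx, -, rfl⟩ := H1.1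
  rw [X_zero_pow] at hx
  have := tangentDim_le hmon hI hr (by decide) hx
  simp only [Nat.one_le_ofNat, le_refl, if_true] at this
  omega
end

section
/- T_{max,2}(16) = 78 and T_{max,3}(16) = 88; in particular, for l = 16 the function m1 ↦ T_{max,m1}(16) is strictly increasing on {1, 2, 3}. -/
open MvPolynomial

/-- The polynomial ring in three variables. -/
abbrev Poly3 := MvPolynomial (Fin 3) ℂ

/-- The set of exponents of standard monomials. -/
def stdSet (I : Ideal Poly3) : Set (Fin 3 →₀ ℕ) := {d | monomial d (1 : ℂ) ∉ I}

/-- Restriction of the coefficients of a polynomial to the standard monomials. -/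
noncomputable def stdPart (I : Ideal Poly3) : Poly3 →ₗ[ℂ] (stdSet I →₀ ℂ) :=
  Finsupp.lsubtypeDomain (stdSet I) ∘ₗ (basisMonomials (Fin 3) ℂ).repr.toLinearMap

lemma stdPart_surjective (I : Ideal Poly3) : Function.Surjective (stdPart I) := by
  intro f
  refine ⟨(basisMonomials (Fin 3) ℂ).repr.symm (f.embDomain (Function.Embedding.subtype _)), ?_⟩
  ext s
  simp only [stdPart, LinearMap.comp_apply, LinearEquiv.coe_coe, LinearEquiv.apply_symm_apply]
  exact Finsupp.embDomain_apply_self _ f s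

lemma mem_of_support {I : Ideal Poly3} {p : Poly3} (hp : ∀ d ∈ p.support, monomial d (1 : ℂ) ∈ I) :
    p ∈ I := by
  rw [← p.support_sum_monomial_coeff]
  refine I.sum_mem fun d hd => ?_
  have : monomial d (coeff d p) = C (coeff d p) * monomial d (1 : ℂ) := by
    rw [C_mul_monomial, mul_one]
  rw [this]
  exact I.mul_mem_left _ (hp d hd)

lemma ker_stdPart {I : Ideal Poly3} (hI : IsMonomialIdeal I) :
    LinearMap.ker (stdPart I) = I.restrictScalars ℂ := by
  ext p
  rw [LinearMap.mem_ker, Submodule.restrictScalars_mem]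
  constructor
  · intro h
    refine mem_of_support fun d hd => ?_
    by_contra hd'
    exact mem_support_iff.1 hd (DFunLike.congr_fun h ⟨d, hd'⟩)
  · intro h
    ext s
    by_contra hs
    exact s.2 (hI p h _ (mem_support_iff.2 hs))

/-- Standard monomials form a basis of the quotient by a monomial ideal. -/
noncomputable def normalForm {I : Ideal Poly3} (hI : IsMonomialIdeal I) :
    (Poly3 ⧸ I) ≃ₗ[ℂ] (stdSet I →₀ ℂ) :=
  (Submodule.Quotient.restrictScalarsEquiv ℂ I).symm ≪≫ₗ
    (Submodule.quotEquivOfEq _ _ (ker_stdPart hI).symm) ≪≫ₗ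
    (stdPart I).quotKerEquivOfSurjective (stdPart_surjective I)

lemma normalForm_mk {I : Ideal Poly3} (hI : IsMonomialIdeal I) (p : Poly3) (s : stdSet I) :
    normalForm hI (Ideal.Quotient.mk I p) s = coeff s.1 p := rfl

lemma finrank_quotient {I : Ideal Poly3} (hI : IsMonomialIdeal I) :
    Module.finrank ℂ (Poly3 ⧸ I) = (stdSet I).ncard := by
  rw [(normalForm hI).finrank_eq, Module.finrank, rank_finsupp_self, Cardinal.toNat_lift]
  rfl

lemma X_smul_mk (I : Ideal Poly3) (i : Fin 3) (p : Poly3) :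
    (X i : Poly3) • Ideal.Quotient.mk I p = Ideal.Quotient.mk I (p * X i) := by
  rw [mul_comm]
  rfl

lemma normalForm_X_smul {I : Ideal Poly3} (hI : IsMonomialIdeal I) (i : Fin 3) (q : Poly3 ⧸ I)
    (t : stdSet I) (t' : stdSet I) (h : t.1 = t'.1 + Finsupp.single i 1) :
    normalForm hI ((X i : Poly3) • q) t = normalForm hI q t' := by
  obtain ⟨p, rfl⟩ := Ideal.Quotient.mk_surjective q
  rw [X_smul_mk, normalForm_mk, normalForm_mk, h, coeff_mul_X]

lemma normalForm_X_smul_eq_zero {I : Ideal Poly3} (hI : IsMonomialIdeal I) (i : Fin 3)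
    (q : Poly3 ⧸ I) (t : stdSet I) (h : t.1 i = 0) : normalForm hI ((X i : Poly3) • q) t = 0 := by
  obtain ⟨p, rfl⟩ := Ideal.Quotient.mk_surjective q
  rw [X_smul_mk, normalForm_mk, coeff_mul_X', if_neg (by simpa using h)]

lemma add_mem_of_mem {I : Ideal Poly3} {d : Fin 3 →₀ ℕ} (e : Fin 3 →₀ ℕ)
    (h : monomial d (1 : ℂ) ∈ I) : monomial (d + e) (1 : ℂ) ∈ I := by
  have : monomial (d + e) (1 : ℂ) = monomial e (1 : ℂ) * monomial d (1 : ℂ) := by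
    rw [monomial_mul, one_mul, add_comm]
  rw [this]
  exact I.mul_mem_left _ h

lemma mem_stdSet_of_add {I : Ideal Poly3} {d e : Fin 3 →₀ ℕ} (h : d + e ∈ stdSet I) :
    d ∈ stdSet I := fun h' => h (add_mem_of_mem e h')

open Classical in
/-- The coefficient of the standard monomial `s` in the image of the monomial `d` of `I`. -/
noncomputable def entry {I : Ideal Poly3} (hI : IsMonomialIdeal I) (d s : Fin 3 →₀ ℕ) :
    (I →ₗ[Poly3] (Poly3 ⧸ I)) →ₗ[ℂ] ℂ where
  toFun φ := if h : monomial d (1 : ℂ) ∈ I ∧ s ∈ stdSet I then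
    normalForm hI (φ ⟨_, h.1⟩) ⟨s, h.2⟩ else 0
  map_add' φ ψ := by
    by_cases h : monomial d (1 : ℂ) ∈ I ∧ s ∈ stdSet I <;> simp [h]
  map_smul' c φ := by
    by_cases h : monomial d (1 : ℂ) ∈ I ∧ s ∈ stdSet I <;> simp [h]

section entry

variable {I : Ideal Poly3} (hI : IsMonomialIdeal I) (φ : I →ₗ[Poly3] (Poly3 ⧸ I)) {d s : Fin 3 →₀ ℕ}

lemma entry_of_mem (hd : monomial d (1 : ℂ) ∈ I) (hs : s ∈ stdSet I) :
    entry hI d s φ = normalForm hI (φ ⟨_, hd⟩) ⟨s, hs⟩ := dif_pos ⟨hd, hs⟩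

lemma apply_monomial_add (i : Fin 3) (hd : monomial d (1 : ℂ) ∈ I) :
    φ ⟨_, add_mem_of_mem (Finsupp.single i 1) hd⟩ = (X i : Poly3) • φ ⟨_, hd⟩ := by
  rw [← map_smul]
  congr 1
  ext1
  simp [X, monomial_mul, add_comm]

lemma entry_add (i : Fin 3) (hd : monomial d (1 : ℂ) ∈ I)
    (hs : s + Finsupp.single i 1 ∈ stdSet I) :
    entry hI (d + Finsupp.single i 1) (s + Finsupp.single i 1) φ = entry hI d s φ := by
  rw [entry_of_mem hI φ (add_mem_of_mem _ hd) hs, entry_of_mem hI φ hd (mem_stdSet_of_add hs),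
    apply_monomial_add, normalForm_X_smul hI i _ _ ⟨s, mem_stdSet_of_add hs⟩ rfl]

lemma entry_add_eq_zero (i : Fin 3) (hd : monomial d (1 : ℂ) ∈ I) (hs : s i = 0) :
    entry hI (d + Finsupp.single i 1) s φ = 0 := by
  by_cases hs' : s ∈ stdSet I
  · rw [entry_of_mem hI φ (add_mem_of_mem _ hd) hs', apply_monomial_add φ i hd,
      normalForm_X_smul_eq_zero hI i _ _ hs]
  · exact dif_neg fun h => hs' h.2

/-- A homomorphism vanishes once its entries at the minimal generators vanish. -/
lemma eq_zero_of_entry (h : ∀ d s, monomial d (1 : ℂ) ∈ I →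
    (∀ i d', d = d' + Finsupp.single i 1 → d' ∈ stdSet I) → s ∈ stdSet I → entry hI d s φ = 0) :
    φ = 0 := by
  have key : ∀ n : ℕ, ∀ d s, d.degree = n → monomial d (1 : ℂ) ∈ I → s ∈ stdSet I →
      entry hI d s φ = 0 := by
    intro n
    induction n with
    | zero =>
      intro d s hn hd hs
      refine h d s hd (fun i d' hd' => ?_) hs
      rw [hd', map_add, Finsupp.degree_single] at hn
      omega
    | succ n ih =>
      intro d s hn hd hs
      by_cases hmin : ∀ i d', d = d' + Finsupp.single i 1 → d' ∈ stdSet I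
      · exact h d s hd hmin hs
      push Not at hmin
      obtain ⟨i, d', rfl, hd'⟩ := hmin
      have hd' : monomial d' (1 : ℂ) ∈ I := not_not.1 hd'
      by_cases hsi : s i = 0
      · exact entry_add_eq_zero hI φ i hd' hsi
      have hs' : s - Finsupp.single i 1 + Finsupp.single i 1 = s :=
        tsub_add_cancel_of_le (Finsupp.single_le_iff.2 (Nat.pos_of_ne_zero hsi))
      rw [← hs'] at hs ⊢
      rw [entry_add hI φ i hd' hs]
      refine ih _ _ ?_ hd' (mem_stdSet_of_add hs)
      rw [map_add, Finsupp.degree_single] at hn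
      omega
  have hmon : ∀ d (hd : monomial d (1 : ℂ) ∈ I), φ ⟨_, hd⟩ = 0 := by
    intro d hd
    apply (normalForm hI).injective
    rw [map_zero]
    ext s
    exact (entry_of_mem hI φ hd s.2).symm.trans (key _ _ _ rfl hd s.2)
  ext1 ⟨p, hp⟩
  have : p ∈ (LinearMap.ker φ).map I.subtype := by
    refine mem_of_support (I := (LinearMap.ker φ).map I.subtype) fun d hd => ?_
    exact ⟨⟨_, hI p hp d hd⟩, hmon _ _, rfl⟩
  obtain ⟨⟨q, hq⟩, h1, rfl⟩ := this
  exact h1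

end entry

/-- Finitely many entries that determine a homomorphism bound the tangent dimension. -/
lemma tangentDim_le {I : Ideal Poly3} (hI : IsMonomialIdeal I) {ι : Type} (B : Finset ι)
    (u v : ι → Fin 3 →₀ ℕ)
    (hB : ∀ φ, (∀ k ∈ B, entry hI (u k) (v k) φ = 0) → φ = 0) :
    Module.Finite ℂ (I →ₗ[Poly3] (Poly3 ⧸ I)) ∧ tangentDim I ≤ B.card := by
  let Φ : (I →ₗ[Poly3] (Poly3 ⧸ I)) →ₗ[ℂ] (B → ℂ) := LinearMap.pi fun k => entry hI (u k) (v k)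
  have hΦ : Function.Injective Φ := by
    rw [← LinearMap.ker_eq_bot, LinearMap.ker_eq_bot']
    exact fun φ hφ => hB φ fun k hk => congrFun hφ ⟨k, hk⟩
  refine ⟨Module.Finite.of_injective Φ hΦ, ?_⟩
  simpa [tangentDim] using LinearMap.finrank_le_finrank_of_injective hΦ

section construct

variable {I : Ideal Poly3} (hI : IsMonomialIdeal I) (hfin : (stdSet I).Finite)
  (f : (Fin 3 →₀ ℕ) → (Fin 3 →₀ ℕ) → ℂ)

/-- The `ℂ`-linear map sending the monomial `d` to the combination of standard monomials with
coefficients `f d`. -/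
noncomputable def ofEntries : Poly3 →ₗ[ℂ] (Poly3 ⧸ I) :=
  have := hfin.to_subtype
  (basisMonomials (Fin 3) ℂ).constr ℂ fun d =>
    (normalForm hI).symm (Finsupp.equivFunOnFinite.symm fun s => f d s)

lemma normalForm_ofEntries (d : Fin 3 →₀ ℕ) (s : stdSet I) :
    normalForm hI (ofEntries hI hfin f (monomial d (1 : ℂ))) s = f d s := by
  have := hfin.to_subtype
  have : monomial d (1 : ℂ) = basisMonomials (Fin 3) ℂ d := by simp
  rw [this, ofEntries, Module.Basis.constr_basis]
  simp

variable (hadd : ∀ d t i, monomial d (1 : ℂ) ∈ I → t + Finsupp.single i 1 ∈ stdSet I →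
    f (d + Finsupp.single i 1) (t + Finsupp.single i 1) = f d t)
  (hzero : ∀ d t i, monomial d (1 : ℂ) ∈ I → t ∈ stdSet I → t i = 0 →
    f (d + Finsupp.single i 1) t = 0)

include hadd hzero in
lemma ofEntries_X_mul (i : Fin 3) (p : Poly3) (hp : p ∈ I) :
    ofEntries hI hfin f (X i * p) = (X i : Poly3) • ofEntries hI hfin f p := by
  rw [← p.support_sum_monomial_coeff, Finset.mul_sum, map_sum, map_sum, Finset.smul_sum]
  refine Finset.sum_congr rfl fun d hd => ?_
  have hd := hI p hp d hd
  have h1 : monomial d (coeff d p) = coeff d p • monomial d (1 : ℂ) := by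
    rw [smul_monomial, smul_eq_mul, mul_one]
  have h2 : (X i : Poly3) * monomial d (1 : ℂ) = monomial (d + Finsupp.single i 1) 1 := by
    simp [X, monomial_mul, add_comm]
  rw [h1, mul_smul_comm, map_smul, map_smul, smul_comm, h2]
  congr 1
  apply (normalForm hI).injective
  ext t
  rw [normalForm_ofEntries]
  by_cases ht : t.1 i = 0
  · rw [normalForm_X_smul_eq_zero hI i _ _ ht, hzero d t i hd t.2 ht]
  · have ht' : t.1 - Finsupp.single i 1 + Finsupp.single i 1 = t.1 :=
      tsub_add_cancel_of_le (Finsupp.single_le_iff.2 (Nat.pos_of_ne_zero ht))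
    have ht2 : t.1 - Finsupp.single i 1 + Finsupp.single i 1 ∈ stdSet I := ht'.symm ▸ t.2
    rw [normalForm_X_smul hI i _ t ⟨_, mem_stdSet_of_add ht2⟩ ht'.symm, normalForm_ofEntries,
      ← hadd d _ i hd ht2, ht']

/-- The homomorphism with prescribed entries. -/
noncomputable def homOfEntries : I →ₗ[Poly3] (Poly3 ⧸ I) where
  toFun p := ofEntries hI hfin f p
  map_add' p q := by simp
  map_smul' q p := by
    obtain ⟨p, hp⟩ := p
    simp only [SetLike.mk_smul_mk, smul_eq_mul, RingHom.id_apply]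
    induction q using MvPolynomial.induction_on with
    | C a => rw [← smul_eq_C_mul, map_smul, ← algebraMap_smul Poly3 a, algebraMap_eq]
    | add q r hq hr => rw [add_mul, map_add, hq, hr, add_smul]
    | mul_X q i hq =>
      rw [mul_comm q, mul_assoc, ofEntries_X_mul hI hfin f hadd hzero i _ (I.mul_mem_left q hp),
        hq, mul_smul]

lemma entry_homOfEntries {d s : Fin 3 →₀ ℕ} (hd : monomial d (1 : ℂ) ∈ I) (hs : s ∈ stdSet I) :
    entry hI d s (homOfEntries hI hfin f hadd hzero) = f d s := by
  rw [entry_of_mem hI _ hd hs]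
  exact normalForm_ofEntries hI hfin f d ⟨s, hs⟩

end construct

/-- Solutions of the entry relations that are dual to some entries bound the tangent dimension
from below. -/
lemma le_tangentDim {I : Ideal Poly3} (hI : IsMonomialIdeal I) (hfin : (stdSet I).Finite)
    (hHom : Module.Finite ℂ (I →ₗ[Poly3] (Poly3 ⧸ I))) {n : ℕ}
    (f : Fin n → (Fin 3 →₀ ℕ) → (Fin 3 →₀ ℕ) → ℂ)
    (hadd : ∀ k d t i, monomial d (1 : ℂ) ∈ I → t + Finsupp.single i 1 ∈ stdSet I →
      f k (d + Finsupp.single i 1) (t + Finsupp.single i 1) = f k d t)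
    (hzero : ∀ k d t i, monomial d (1 : ℂ) ∈ I → t ∈ stdSet I → t i = 0 →
      f k (d + Finsupp.single i 1) t = 0)
    (u v : Fin n → Fin 3 →₀ ℕ) (hu : ∀ k, monomial (u k) (1 : ℂ) ∈ I) (hv : ∀ k, v k ∈ stdSet I)
    (hdual : ∀ j k, f j (u k) (v k) = if j = k then 1 else 0) : n ≤ tangentDim I := by
  have hli : LinearIndependent ℂ fun k => homOfEntries hI hfin (f k) (hadd k) (hzero k) := by
    rw [Fintype.linearIndependent_iff]
    intro c hc k
    have := congrArg (entry hI (u k) (v k)) hc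
    rw [map_sum, map_zero] at this
    simpa [entry_homOfEntries hI hfin _ _ _ (hu k) (hv k), hdual] using this
  simpa [tangentDim] using hli.fintype_card_le_finrank


/-- Nonnegative sequences, strictly decreasing while positive, with first entry at most `u`,
entries bounded by those of the given list, and sum `n`. -/
def stairs : List ℕ → ℕ → ℕ → List (List ℕ)
  | [], _, n => bif Nat.beq n 0 then [[]] else []
  | v :: vs, u, n =>
    (List.range (min (min u v) n + 1)).flatMap fun x => (stairs vs (x - 1) (n - x)).map (x :: ·)

/-- The codes `k + 20 * b + c` with `c` less than the entry of the list at `b`. -/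
def rowCodes : ℕ → List ℕ → List ℕ
  | _, [] => []
  | k, h :: t => (List.range h).map (k + ·) ++ rowCodes (k + 20) t

/-- The codes of the standard monomials of an ideal given by three rows of column heights. -/
def stdCodes (r₀ r₁ r₂ : List ℕ) : List ℕ :=
  rowCodes 0 r₀ ++ (rowCodes 160 r₁ ++ rowCodes 320 r₂)

/-- The bit set obtained from the bit sets `f k` by shifting them by `w * k`. -/
def unionShift (f : ℕ → ℕ) (w : ℕ) : List ℕ → ℕ
  | [] => 0
  | k :: l => (f k <<< (w * k)) ||| unionShift f w l

/-- Difference of bit sets. -/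
def without (x y : ℕ) : ℕ := x ^^^ (x &&& y)

/-- The bit set of the indices of all exponents in a box, where the exponent `(a, b, c)` has index
`160 * (a + 1) + 20 * (b + 1) + (c + 1)`. -/
def boxMask : ℕ :=
  unionShift (fun _ => unionShift (fun _ => 2 ^ 20 - 2) 20 [1, 2, 3, 4, 5, 6, 7]) 160
    [1, 2, 3, 4, 5]

/-- Replaces each pair of the bit set `St` by its translate by `e`, if that translate lies in `N`,
and removes the pairs in `D`. -/
def pushUp (N D e St : ℕ) : ℕ :=
  without (((St <<< (961 * e)) &&& N) ||| without St (N >>> (961 * e))) D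

/-- The analogue of `pushUp` for translation by `-e`. -/
def pushDown (N D e St : ℕ) : ℕ :=
  without (((St >>> (961 * e)) &&& N) ||| without St (N <<< (961 * e))) D

/-- Application of a function to a natural number that is evaluated first. -/
def force {α : Type} (n : ℕ) (k : ℕ → α) : α :=
  match n with
  | 0 => k 0
  | m + 1 => k (Nat.succ m)

/-- Iteration of `pushUp` and `pushDown`. -/
def push (N D : ℕ) : List (Bool × ℕ) → ℕ → ℕ
  | [], St => St
  | (true, e) :: l, St => push N D l (pushUp N D e St)
  | (false, e) :: l, St => push N D l (pushDown N D e St)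

/-- Whether a bit set has at most the given number of elements. -/
def popLe : ℕ → ℕ → Bool
  | 0, x => Nat.beq x 0
  | n + 1, x => Nat.beq x 0 || popLe n (x &&& (x - 1))

/-- The indices of the monomials in the ideal with standard codes `S`. -/
def idealMask (S : List ℕ) : ℕ := without boxMask (unionShift (fun _ => 1) 1 S <<< 181)

/-- The indices of the minimal generators. -/
def minMask (IM : ℕ) : ℕ := without (without (without IM (IM <<< 1)) (IM <<< 20)) (IM <<< 160)

/-- The indices of the monomials whose image has coefficient zero at the standard monomial with
code `s` since the exponent of some variable cannot be decreased at `s`. -/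
def deadAt (IM s : ℕ) : ℕ :=
  (bif Nat.beq (s % 20) 0 then IM &&& (IM <<< 1) else 0) |||
  ((bif Nat.beq (s / 20 % 8) 0 then IM &&& (IM <<< 20) else 0) |||
  (bif Nat.beq (s / 160) 0 then IM &&& (IM <<< 160) else 0))

/-- Whether transporting all pairs of a minimal generator and a standard monomial along `P` leaves
at most `T` pairs. -/
def bounded (S : List ℕ) (P : List (Bool × ℕ)) (T : ℕ) : Bool :=
  force (idealMask S) fun IM =>
  force (unionShift (fun _ => IM) 960 S) fun N =>
  force (unionShift (deadAt IM) 960 S) fun D =>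
  popLe T (push N D P (unionShift (fun _ => minMask IM) 960 S))

/-- A sequence of transports between neighbouring pairs. -/
def sweep : List (Bool × ℕ) :=
  [(true, 160), (false, 1), (false, 1), (false, 1), (true, 20), (true, 20), (true, 20), (false, 1),
   (true, 20), (false, 20), (false, 20), (false, 20), (true, 1), (false, 20), (false, 160),
   (true, 1), (true, 1), (true, 1),
   (true, 1), (true, 1), (true, 1), (false, 160), (false, 1), (false, 1), (false, 1),
   (true, 20), (true, 20), (true, 20), (false, 1), (false, 1), (false, 1), (true, 20),
   (false, 20), (false, 20), (false, 20), (true, 1), (true, 1), (true, 1), (false, 20),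
   (true, 1), (true, 1), (true, 1), (false, 20), (true, 160)]

/-- The upper bound for the tangent dimension, depending on the smallest pure power of `x`. -/
def target (r₁ r₂ : List ℕ) : ℕ :=
  match r₂, r₁ with
  | 0 :: _, 0 :: _ => 77
  | 0 :: _, _ => 78
  | _, _ => 88

/-- The column heights of the Borel-fixed ideals of colength 16 containing `x ^ 3`. -/
def ideals : List (List ℕ × List ℕ × List ℕ) :=
  (List.range 17).flatMap fun n₀ => (stairs [16,16,16,16,16] 16 n₀).flatMap fun r₀ =>
  (List.range (17 - n₀)).flatMap fun n₁ => (stairs r₀.tail 16 n₁).flatMap fun r₁ =>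
  (stairs r₁.tail 16 (16 - n₀ - n₁)).map fun r₂ => (r₀, r₁, r₂)


section bits

lemma testBit_without (x y k : ℕ) :
    (without x y).testBit k = (x.testBit k && !y.testBit k) := by
  rw [without, Nat.testBit_xor, Nat.testBit_and]
  cases x.testBit k <;> simp

lemma testBit_unionShift (f : ℕ → ℕ) (w k : ℕ) (l : List ℕ) :
    (unionShift f w l).testBit k = true ↔
      ∃ s ∈ l, w * s ≤ k ∧ (f s).testBit (k - w * s) = true := by
  induction l with
  | nil => simp [unionShift]
  | cons s l ih => simp [unionShift, ih]

lemma testBit_unionShift_block {f : ℕ → ℕ} {l : List ℕ} {w : ℕ}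
    (hf : ∀ s m, (f s).testBit m = true → m < w) (k : ℕ) :
    (unionShift f w l).testBit k = true ↔
      k / w ∈ l ∧ (f (k / w)).testBit (k % w) = true := by
  rw [testBit_unionShift]
  constructor
  · rintro ⟨s, hs, hk, hm⟩
    have hlt := hf _ _ hm
    have h1 : k / w = s := Nat.div_eq_of_lt_le (by rwa [mul_comm])
      (by rw [add_mul, one_mul, mul_comm]; omega)
    have h2 : k % w = k - w * s := by rw [Nat.mod_eq_sub_mul_div, h1]
    rw [h1, h2]
    exact ⟨hs, hm⟩
  · rintro ⟨hs, hm⟩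
    refine ⟨_, hs, Nat.mul_div_le _ _, ?_⟩
    rwa [← Nat.mod_eq_sub_mul_div]

lemma testBit_pop (x : ℕ) :
    ∃ i, ∀ k, k ≠ i → x.testBit k = true → (x &&& (x - 1)).testBit k = true := by
  induction x using Nat.strong_induction_on with
  | _ x ih =>
    rcases Nat.eq_zero_or_pos x with rfl | hx
    · exact ⟨0, by simp⟩
    rcases Nat.mod_two_eq_zero_or_one x with h | h
    · obtain ⟨i, hi⟩ := ih (x / 2) (by omega)
      refine ⟨i + 1, fun k hk hb => ?_⟩
      cases k with
      | zero => simp [Nat.testBit_zero, h] at hb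
      | succ k =>
        have := hi k (by omega)
        rw [Nat.testBit_and] at this ⊢
        rw [Nat.testBit_succ] at hb ⊢
        rw [Nat.testBit_succ, show (x - 1) / 2 = x / 2 - 1 by omega]
        exact this hb
    · refine ⟨0, fun k hk hb => ?_⟩
      obtain ⟨k, rfl⟩ := Nat.exists_eq_succ_of_ne_zero hk
      rw [Nat.succ_eq_add_one, Nat.testBit_succ] at hb
      rw [Nat.testBit_and, Nat.succ_eq_add_one, Nat.testBit_succ, Nat.testBit_succ,
        show (x - 1) / 2 = x / 2 by omega, hb, Bool.and_self]

lemma exists_finset_of_popLe {n x : ℕ} (h : popLe n x = true) :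
    ∃ B : Finset ℕ, B.card ≤ n ∧ ∀ k, x.testBit k = true → k ∈ B := by
  induction n generalizing x with
  | zero => exact ⟨∅, by simp, by simp [Nat.eq_of_beq_eq_true h]⟩
  | succ n ih =>
    rw [popLe, Bool.or_eq_true] at h
    rcases h with h | h
    · exact ⟨∅, by simp, by simp [Nat.eq_of_beq_eq_true h]⟩
    · obtain ⟨B, hB, hB'⟩ := ih h
      obtain ⟨i, hi⟩ := testBit_pop x
      refine ⟨insert i B, (Finset.card_insert_le _ _).trans (by omega), fun k hk => ?_⟩
      by_cases hki : k = i
      · simp [hki]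
      · exact Finset.mem_insert_of_mem (hB' k (hi k hki hk))

lemma force_eq {α : Type} (n : ℕ) (k : ℕ → α) : force n k = k n := by
  cases n <;> rfl

/-- The indices of the points of the box. -/
def InBox (k : ℕ) : Prop := k < 960 ∧ k % 20 ≠ 0 ∧ k / 20 % 8 ≠ 0 ∧ k / 160 ≠ 0

set_option exponentiation.threshold 1000 in
lemma testBit_boxMask (k : ℕ) : boxMask.testBit k = true ↔ InBox k := by
  have h1 : boxMask < 2 ^ 960 := by decide +kernel
  have h2 : ∀ k < 960, boxMask.testBit k = true ↔ k % 20 ≠ 0 ∧ k / 20 % 8 ≠ 0 ∧ k / 160 ≠ 0 := by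
    decide +kernel
  by_cases hk : k < 960
  · rw [h2 k hk, InBox, and_iff_right hk]
  · rw [Nat.testBit_lt_two_pow (h1.trans_le (Nat.pow_le_pow_right two_pos (by omega)))]
    simp [InBox, hk]

section push

variable {F : ℕ → ℂ} {N D : ℕ}

lemma eq_zero_of_pushUp {e St : ℕ} (hD : ∀ k, D.testBit k = true → F k = 0)
    (hN : ∀ j, N.testBit j = true → N.testBit (j + 961 * e) = true → F (j + 961 * e) = F j)
    (hSt : ∀ k, St.testBit k = true → N.testBit k = true)
    (h : ∀ k, (pushUp N D e St).testBit k = true → F k = 0) :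
    ∀ k, St.testBit k = true → F k = 0 := by
  intro k hk
  simp only [pushUp, testBit_without, Nat.testBit_or, Nat.testBit_and, Nat.testBit_shiftLeft,
    Nat.testBit_shiftRight] at h
  by_cases hk' : N.testBit (k + 961 * e) = true
  · rw [← hN k (hSt k hk) hk']
    by_cases hd : D.testBit (k + 961 * e) = true
    · exact hD _ hd
    · exact h _ (by simp [hk, hk', hd])
  · by_cases hd : D.testBit k = true
    · exact hD _ hd
    · exact h _ (by simp [hk, add_comm _ k, hk', hd])

lemma eq_zero_of_pushDown {e St : ℕ} (hD : ∀ k, D.testBit k = true → F k = 0)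
    (hN : ∀ j, N.testBit j = true → N.testBit (j + 961 * e) = true → F (j + 961 * e) = F j)
    (hSt : ∀ k, St.testBit k = true → N.testBit k = true)
    (h : ∀ k, (pushDown N D e St).testBit k = true → F k = 0) :
    ∀ k, St.testBit k = true → F k = 0 := by
  intro k hk
  simp only [pushDown, testBit_without, Nat.testBit_or, Nat.testBit_and, Nat.testBit_shiftLeft,
    Nat.testBit_shiftRight] at h
  by_cases hk' : 961 * e ≤ k ∧ N.testBit (k - 961 * e) = true
  · obtain ⟨j, rfl⟩ := Nat.exists_eq_add_of_le' hk'.1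
    rw [Nat.add_sub_cancel] at hk'
    rw [hN j hk'.2 (hSt _ hk)]
    by_cases hd : D.testBit j = true
    · exact hD _ hd
    · exact h _ (by simp [add_comm _ j, hk, hk'.2, hd])
  · by_cases hd : D.testBit k = true
    · exact hD _ hd
    · refine h _ ?_
      rw [not_and, Bool.not_eq_true] at hk'
      by_cases hle : 961 * e ≤ k
      · simp [hk, hk' hle, hd]
      · simp [hk, hle, hd]

lemma pushUp_subset {e St : ℕ} (hSt : ∀ k, St.testBit k = true → N.testBit k = true) (k : ℕ)
    (h : (pushUp N D e St).testBit k = true) : N.testBit k = true := by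
  simp only [pushUp, testBit_without, Nat.testBit_or, Nat.testBit_and, Bool.and_eq_true,
    Bool.or_eq_true] at h
  rcases h.1 with h | h
  · exact h.2
  · exact hSt k h.1

lemma pushDown_subset {e St : ℕ} (hSt : ∀ k, St.testBit k = true → N.testBit k = true) (k : ℕ)
    (h : (pushDown N D e St).testBit k = true) : N.testBit k = true := by
  simp only [pushDown, testBit_without, Nat.testBit_or, Nat.testBit_and, Bool.and_eq_true,
    Bool.or_eq_true] at h
  rcases h.1 with h | h
  · exact h.2
  · exact hSt k h.1

lemma eq_zero_of_push {P : List (Bool × ℕ)} {St : ℕ} (hD : ∀ k, D.testBit k = true → F k = 0)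
    (hN : ∀ p ∈ P, ∀ j, N.testBit j = true → N.testBit (j + 961 * p.2) = true →
      F (j + 961 * p.2) = F j)
    (hSt : ∀ k, St.testBit k = true → N.testBit k = true)
    (h : ∀ k, (push N D P St).testBit k = true → F k = 0) :
    ∀ k, St.testBit k = true → F k = 0 := by
  induction P generalizing St with
  | nil => exact h
  | cons p P ih =>
    have hp := hN p (by simp)
    have hP := fun q (hq : q ∈ P) => hN q (List.mem_cons_of_mem _ hq)
    obtain ⟨_ | _, e⟩ := p
    · exact eq_zero_of_pushDown hD hp hSt (ih hP (pushDown_subset hSt) h)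
    · exact eq_zero_of_pushUp hD hp hSt (ih hP (pushUp_subset hSt) h)

end push

end bits

/-- The exponent with the given coordinates. -/
noncomputable def expo (a b c : ℕ) : Fin 3 →₀ ℕ := Finsupp.equivFunOnFinite.symm ![a, b, c]

@[simp] lemma expo_zero (a b c : ℕ) : expo a b c 0 = a := rfl
@[simp] lemma expo_one (a b c : ℕ) : expo a b c 1 = b := rfl
@[simp] lemma expo_two (a b c : ℕ) : expo a b c 2 = c := rfl

lemma expo_ext {d e : Fin 3 →₀ ℕ} (h0 : d 0 = e 0) (h1 : d 1 = e 1) (h2 : d 2 = e 2) : d = e := by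
  ext i
  fin_cases i <;> assumption

lemma expo_eta (d : Fin 3 →₀ ℕ) : expo (d 0) (d 1) (d 2) = d := expo_ext rfl rfl rfl

/-- The point of the box with index `k`. -/
noncomputable def boxPoint (k : ℕ) : Fin 3 →₀ ℕ := expo (k / 160 - 1) (k / 20 % 8 - 1) (k % 20 - 1)

/-- The exponent with code `s`. -/
noncomputable def codePoint (s : ℕ) : Fin 3 →₀ ℕ := expo (s / 160) (s / 20 % 8) (s % 20)

/-- The code of an exponent. -/
def code (d : Fin 3 →₀ ℕ) : ℕ := 160 * d 0 + 20 * d 1 + d 2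

/-- The change of `code` under multiplication by a variable. -/
def weight : Fin 3 → ℕ
  | 0 => 160
  | 1 => 20
  | 2 => 1

/-- The list `S` consists of the codes of the standard monomials of `I`. -/
structure Encodes (S : List ℕ) (I : Ideal Poly3) : Prop where
  codePoint_mem : ∀ s ∈ S, codePoint s ∈ stdSet I
  bounds : ∀ d ∈ stdSet I, d 0 ≤ 2 ∧ d 1 ≤ 4 ∧ d 2 ≤ 15
  code_mem : ∀ d ∈ stdSet I, code d ∈ S

section Encodes

variable {S : List ℕ} {I : Ideal Poly3} (hS : Encodes S I)
include hS

lemma Encodes.digits {s : ℕ} (hs : s ∈ S) : s / 160 ≤ 2 ∧ s / 20 % 8 ≤ 4 ∧ s % 20 ≤ 15 :=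
  hS.bounds _ (hS.codePoint_mem s hs)

lemma Encodes.testBit_idealMask (k : ℕ) :
    (idealMask S).testBit k = true ↔ InBox k ∧ monomial (boxPoint k) (1 : ℂ) ∈ I := by
  rw [idealMask, testBit_without, Bool.and_eq_true, testBit_boxMask]
  refine and_congr_right fun hk => ?_
  obtain ⟨h1, h2, h3, h4⟩ := hk
  have hlow : (unionShift (fun _ => 1) 1 S <<< 181).testBit k = true ↔ k - 181 ∈ S := by
    rw [Nat.testBit_shiftLeft, Bool.and_eq_true, decide_eq_true_iff,
      testBit_unionShift_block (fun _ m hm => by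
        by_contra h
        rw [Nat.testBit_one_eq_true_iff_self_eq_zero] at hm
        omega)]
    simp only [Nat.div_one, Nat.mod_one, ge_iff_le]
    constructor
    · exact fun h => h.2.1
    · exact fun h => ⟨by omega, h, rfl⟩
  rw [Bool.not_eq_true', ← Bool.not_eq_true, hlow]
  have hpt : codePoint (k - 181) = boxPoint k := by
    refine expo_ext ?_ ?_ ?_ <;> simp only [codePoint, boxPoint, expo_zero, expo_one, expo_two] <;>
      omega
  constructor
  · intro h
    by_contra hmem
    have := hS.code_mem _ hmem
    have hcode : code (boxPoint k) = k - 181 := by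
      simp only [code, boxPoint, expo_zero, expo_one, expo_two]
      omega
    rw [hcode] at this
    exact h this
  · intro h hmem
    have := hS.codePoint_mem _ hmem
    rw [hpt] at this
    exact this h

variable (hI : IsMonomialIdeal I) (φ : I →ₗ[Poly3] (Poly3 ⧸ I))

lemma Encodes.testBit_pairs (k : ℕ) :
    (unionShift (fun _ => idealMask S) 960 S).testBit k = true ↔
      k / 960 ∈ S ∧ InBox (k % 960) ∧ monomial (boxPoint (k % 960)) (1 : ℂ) ∈ I := by
  rw [testBit_unionShift_block fun _ m hm => ((hS.testBit_idealMask m).1 hm).1.1,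
    hS.testBit_idealMask]

/-- The entry at the pair with index `k`. -/
noncomputable def pairEntry (hI : IsMonomialIdeal I) (φ : I →ₗ[Poly3] (Poly3 ⧸ I)) (k : ℕ) : ℂ :=
  entry hI (boxPoint (k % 960)) (codePoint (k / 960)) φ

omit hS in
lemma boxPoint_add {k : ℕ} (i : Fin 3) (hk : InBox k) (hk' : InBox (k + weight i)) :
    boxPoint (k + weight i) = boxPoint k + Finsupp.single i 1 := by
  simp only [InBox] at hk hk'
  fin_cases i <;> refine expo_ext ?_ ?_ ?_ <;>
    simp [boxPoint, weight] at hk' ⊢ <;> omega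

lemma Encodes.codePoint_add {s : ℕ} (i : Fin 3) (hs : s ∈ S) :
    codePoint (s + weight i) = codePoint s + Finsupp.single i 1 := by
  have := hS.digits hs
  fin_cases i <;> refine expo_ext ?_ ?_ ?_ <;> simp [codePoint, weight] <;> omega

lemma Encodes.pairEntry_add (i : Fin 3) (j : ℕ)
    (hj : (unionShift (fun _ => idealMask S) 960 S).testBit j = true)
    (hj' : (unionShift (fun _ => idealMask S) 960 S).testBit (j + 961 * weight i) = true) :
    pairEntry hI φ (j + 961 * weight i) = pairEntry hI φ j := by
  rw [hS.testBit_pairs] at hj hj'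
  obtain ⟨h1, h2, h3⟩ := hj
  obtain ⟨h4, h5, h6⟩ := hj'
  have hw : weight i = 1 ∨ weight i = 20 ∨ weight i = 160 := by fin_cases i <;> simp [weight]
  have hmod : (j + 961 * weight i) % 960 = j % 960 + weight i := by
    simp only [InBox] at h2 h5
    rcases hw with hw | hw | hw <;> rw [hw] at h5 ⊢ <;> omega
  have hdiv : (j + 961 * weight i) / 960 = j / 960 + weight i := by omega
  rw [pairEntry, pairEntry, hmod, hdiv, boxPoint_add i h2 (hmod ▸ h5), hS.codePoint_add i h1]
  refine entry_add hI φ i h3 ?_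
  rw [← hS.codePoint_add i h1, ← hdiv]
  exact hS.codePoint_mem _ h4

lemma Encodes.pairEntry_eq_zero_of_shift (i : Fin 3) {s m : ℕ} (hs : codePoint s i = 0)
    (h : (idealMask S &&& (idealMask S <<< weight i)).testBit m = true) :
    entry hI (boxPoint m) (codePoint s) φ = 0 := by
  rw [Nat.testBit_and, Nat.testBit_shiftLeft, Bool.and_eq_true, Bool.and_eq_true,
    decide_eq_true_iff] at h
  obtain ⟨h1, hle, h2⟩ := h
  obtain ⟨m, rfl⟩ := Nat.exists_eq_add_of_le' hle
  rw [Nat.add_sub_cancel, hS.testBit_idealMask] at h2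
  rw [hS.testBit_idealMask] at h1
  rw [boxPoint_add i h2.1 h1.1]
  exact entry_add_eq_zero hI φ i h2.2 hs

omit hS in
lemma testBit_of_deadAt {IM s m : ℕ} (h : (deadAt IM s).testBit m = true) :
    ∃ i, codePoint s i = 0 ∧ (IM &&& (IM <<< weight i)).testBit m = true := by
  have aux : ∀ {b : Bool} {x : ℕ}, (bif b then x else 0).testBit m = true →
      b = true ∧ x.testBit m = true := by
    rintro (_ | _) x hx
    · simp at hx
    · exact ⟨rfl, hx⟩
  rw [deadAt, Nat.testBit_or, Bool.or_eq_true, Nat.testBit_or, Bool.or_eq_true] at h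
  rcases h with h | h | h
  · exact ⟨2, Nat.eq_of_beq_eq_true (aux h).1, (aux h).2⟩
  · exact ⟨1, Nat.eq_of_beq_eq_true (aux h).1, (aux h).2⟩
  · exact ⟨0, Nat.eq_of_beq_eq_true (aux h).1, (aux h).2⟩

lemma Encodes.pairEntry_eq_zero (k : ℕ)
    (h : (unionShift (deadAt (idealMask S)) 960 S).testBit k = true) : pairEntry hI φ k = 0 := by
  rw [testBit_unionShift_block] at h
  · obtain ⟨i, hi, h⟩ := testBit_of_deadAt h.2
    exact hS.pairEntry_eq_zero_of_shift hI φ i hi h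
  · intro s m hm
    obtain ⟨i, -, h⟩ := testBit_of_deadAt hm
    rw [Nat.testBit_and, Bool.and_eq_true] at h
    exact ((hS.testBit_idealMask m).1 h.1).1.1

omit hS in
lemma testBit_minMask {IM m : ℕ} :
    (minMask IM).testBit m = true ↔
      IM.testBit m = true ∧ ∀ i, (IM <<< weight i).testBit m ≠ true := by
  rw [minMask, testBit_without, testBit_without, testBit_without, Fin.forall_fin_succ,
    Fin.forall_fin_two]
  simp only [weight, Bool.and_eq_true, Bool.not_eq_true', ne_eq, Bool.not_eq_true]
  exact ⟨fun h => ⟨h.1.1.1, h.2, h.1.2, h.1.1.2⟩, fun h => ⟨⟨⟨h.1, h.2.2.2⟩, h.2.2.1⟩, h.2.1⟩⟩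

lemma Encodes.eq_zero_of_minMask
    (h : ∀ k, (unionShift (fun _ => minMask (idealMask S)) 960 S).testBit k = true →
      pairEntry hI φ k = 0) : φ = 0 := by
  refine eq_zero_of_entry hI φ fun d s hd hmin hs => ?_
  have hbd : d 0 ≤ 3 ∧ d 1 ≤ 5 ∧ d 2 ≤ 16 := by
    have aux : ∀ i, 0 < d i → d - Finsupp.single i 1 ∈ stdSet I := fun i hi =>
      hmin i _ (tsub_add_cancel_of_le (Finsupp.single_le_iff.2 hi)).symm
    refine ⟨?_, ?_, ?_⟩ <;> by_contra! hlt
    · have := (hS.bounds _ (aux 0 (by omega))).1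
      simp at this
      omega
    · have := (hS.bounds _ (aux 1 (by omega))).2.1
      simp at this
      omega
    · have := (hS.bounds _ (aux 2 (by omega))).2.2
      simp at this
      omega
  have hs' := hS.bounds s hs
  have hbox : InBox (code d + 181) := by
    simp only [InBox, code]
    omega
  have hpt : boxPoint (code d + 181) = d := by
    refine expo_ext ?_ ?_ ?_ <;> simp only [code, boxPoint, expo_zero, expo_one, expo_two] <;> omega
  have hcp : codePoint (code s) = s := by
    refine expo_ext ?_ ?_ ?_ <;> simp only [code, codePoint, expo_zero, expo_one, expo_two] <;>
      omega
  have hdiv : (960 * code s + (code d + 181)) / 960 = code s := by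
    have := hbox.1
    omega
  have hmod : (960 * code s + (code d + 181)) % 960 = code d + 181 := by
    have := hbox.1
    omega
  have := h (960 * code s + (code d + 181)) ?_
  · rwa [pairEntry, hdiv, hmod, hpt, hcp] at this
  rw [testBit_unionShift_block fun _ m hm =>
    ((hS.testBit_idealMask m).1 (testBit_minMask.1 hm).1).1.1, hdiv, hmod, testBit_minMask,
    hS.testBit_idealMask, hpt]
  refine ⟨hS.code_mem s hs, ⟨hbox, hd⟩, fun i hi => ?_⟩
  rw [Nat.testBit_shiftLeft, Bool.and_eq_true, decide_eq_true_iff, hS.testBit_idealMask] at hi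
  obtain ⟨hle, hb, hmem⟩ := hi
  obtain ⟨m, hm⟩ := Nat.exists_eq_add_of_le' hle
  rw [hm, Nat.add_sub_cancel] at hb hmem
  rw [hm] at hbox hpt
  exact hmin i (boxPoint m) (by rw [← hpt, boxPoint_add i hb hbox]) hmem

include hI in
/-- Soundness of the check performed by `bounded`. -/
lemma Encodes.tangentDim_le {T : ℕ} (h : bounded S sweep T = true) :
    Module.Finite ℂ (I →ₗ[Poly3] (Poly3 ⧸ I)) ∧ tangentDim I ≤ T := by
  simp only [bounded, force_eq] at h
  obtain ⟨B, hB, hmem⟩ := exists_finset_of_popLe h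
  have := _root_.tangentDim_le hI B (fun k => boxPoint (k % 960)) (fun k => codePoint (k / 960)) ?_
  · exact ⟨this.1, this.2.trans hB⟩
  intro φ hφ
  refine hS.eq_zero_of_minMask hI φ (eq_zero_of_push (P := sweep) (hS.pairEntry_eq_zero hI φ) ?_ ?_
    fun k hk => hφ k (hmem k hk))
  · have hw : ∀ p ∈ sweep, ∃ i, p.2 = weight i := by decide
    intro p hp j
    obtain ⟨i, hi⟩ := hw p hp
    rw [hi]
    exact hS.pairEntry_add hI φ i j
  · intro k hk
    rw [testBit_unionShift_block fun _ m hm =>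
      ((hS.testBit_idealMask m).1 (testBit_minMask.1 hm).1).1.1, testBit_minMask,
      hS.testBit_idealMask] at hk
    rw [hS.testBit_pairs]
    exact ⟨hk.1, hk.2.1⟩

end Encodes

lemma mem_rowCodes {k x : ℕ} {r : List ℕ} :
    x ∈ rowCodes k r ↔ ∃ b c, c < r.getD b 0 ∧ x = k + 20 * b + c := by
  induction r generalizing k with
  | nil => simp [rowCodes]
  | cons h t ih =>
    rw [rowCodes, List.mem_append, ih, List.mem_map]
    constructor
    · rintro (⟨c, hc, rfl⟩ | ⟨b, c, hc, rfl⟩)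
      · exact ⟨0, c, by simpa using hc, by omega⟩
      · exact ⟨b + 1, c, by simpa using hc, by omega⟩
    · rintro ⟨_ | b, c, hc, rfl⟩
      · exact Or.inl ⟨c, by simpa using hc, by omega⟩
      · exact Or.inr ⟨b, c, by simpa using hc, by omega⟩

/-- The number of standard monomials `x ^ a * y ^ b * z ^ c` with `a` and `b` fixed. -/
noncomputable def height (I : Ideal Poly3) (a b : ℕ) : ℕ :=
  sInf {c | monomial (expo a b c) (1 : ℂ) ∈ I}

section height

variable {I : Ideal Poly3}

lemma monomial_mem_of_le {d e : Fin 3 →₀ ℕ} (h : d ≤ e) (hd : monomial d (1 : ℂ) ∈ I) :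
    monomial e (1 : ℂ) ∈ I := by
  have := add_mem_of_mem (e - d) hd
  rwa [add_tsub_cancel_of_le h] at this

lemma expo_le_expo {a b c a' b' c' : ℕ} (ha : a ≤ a') (hb : b ≤ b') (hc : c ≤ c') :
    expo a b c ≤ expo a' b' c' := by
  intro i
  fin_cases i <;> assumption

variable (hfin : (stdSet I).Finite)
include hfin

lemma monomial_height_mem (a b : ℕ) : monomial (expo a b (height I a b)) (1 : ℂ) ∈ I := by
  refine Nat.sInf_mem (s := {c | monomial (expo a b c) (1 : ℂ) ∈ I}) ?_
  by_contra hne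
  refine Set.infinite_of_injective_forall_mem (f := fun c => expo a b c) (s := stdSet I)
    (fun c c' h => DFunLike.congr_fun h 2) (fun c hc => hne ⟨c, hc⟩) hfin

lemma monomial_mem_iff (a b c : ℕ) : monomial (expo a b c) (1 : ℂ) ∈ I ↔ height I a b ≤ c :=
  ⟨fun h => Nat.sInf_le h, fun h =>
    monomial_mem_of_le (expo_le_expo le_rfl le_rfl h) (monomial_height_mem hfin a b)⟩

lemma mem_stdSet_iff (d : Fin 3 →₀ ℕ) : d ∈ stdSet I ↔ d 2 < height I (d 0) (d 1) := by
  rw [← not_le, ← monomial_mem_iff hfin, expo_eta]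
  rfl

lemma card_columns (P : Finset (ℕ × ℕ)) :
    ∑ p ∈ P, height I p.1 p.2 ≤ (stdSet I).ncard ∧
    ((∀ d ∈ stdSet I, (d 0, d 1) ∈ P) → ∑ p ∈ P, height I p.1 p.2 = (stdSet I).ncard) := by
  classical
  let G : Finset (Fin 3 →₀ ℕ) :=
    (P.sigma fun p => Finset.range (height I p.1 p.2)).image fun q => expo q.1.1 q.1.2 q.2
  have hG : G.card = ∑ p ∈ P, height I p.1 p.2 := by
    rw [Finset.card_image_of_injective, Finset.card_sigma]
    · simp
    · rintro ⟨⟨a, b⟩, c⟩ ⟨⟨a', b'⟩, c'⟩ h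
      have h0 : a = a' := DFunLike.congr_fun h 0
      have h1 : b = b' := DFunLike.congr_fun h 1
      have h2 : c = c' := DFunLike.congr_fun h 2
      subst h0 h1 h2
      rfl
  have hsub : (G : Set (Fin 3 →₀ ℕ)) ⊆ stdSet I := by
    intro d hd
    obtain ⟨⟨⟨a, b⟩, c⟩, hq, rfl⟩ := Finset.mem_image.1 (Finset.mem_coe.1 hd)
    rw [mem_stdSet_iff hfin]
    simpa using (Finset.mem_sigma.1 hq).2
  rw [← hG, ← Set.ncard_coe_finset]
  refine ⟨Set.ncard_le_ncard hsub hfin, fun h => congrArg _ (hsub.antisymm fun d hd => ?_)⟩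
  rw [Finset.mem_coe, Finset.mem_image]
  refine ⟨⟨(d 0, d 1), d 2⟩, ?_, expo_eta d⟩
  rw [Finset.mem_sigma, Finset.mem_range]
  exact ⟨h d hd, (mem_stdSet_iff hfin d).1 hd⟩

variable (hB : IsBorelFixed I)
include hB

lemma height_succ_right (a b : ℕ) : height I a (b + 1) ≤ height I a b - 1 := by
  rw [← monomial_mem_iff hfin]
  have h := monomial_height_mem hfin a b
  rcases Nat.eq_zero_or_pos (height I a b) with h0 | h0
  · exact monomial_mem_of_le (expo_le_expo le_rfl (Nat.le_succ b) (by omega)) h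
  · have := hB _ h 1 2 (by decide) h0
    convert this using 3
    refine expo_ext ?_ ?_ ?_ <;> simp

lemma height_succ_left_le (a b : ℕ) : height I (a + 1) b ≤ height I a (b + 1) := by
  rw [← monomial_mem_iff hfin]
  have := hB _ (monomial_height_mem hfin a (b + 1)) 0 1 (by decide) (Nat.succ_pos b)
  convert this using 3
  refine expo_ext ?_ ?_ ?_ <;> simp

lemma height_le_sub (a b : ℕ) : height I a b ≤ height I a 0 - b := by
  induction b with
  | zero => exact le_rfl
  | succ b ih =>
    have := height_succ_right hfin hB a b
    omega

lemma height_le_height_zero (a b : ℕ) : height I a b ≤ height I 0 (b + a) := by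
  induction a generalizing b with
  | zero => exact le_rfl
  | succ a ih =>
    refine (height_succ_left_le hfin hB a b).trans ((ih (b + 1)).trans_eq ?_)
    rw [add_right_comm, add_assoc]

end height

lemma encodes_stdCodes {I : Ideal Poly3} {h : ℕ → ℕ → ℕ}
    (hstd : ∀ d, d ∈ stdSet I ↔ d 2 < h (d 0) (d 1))
    (hbd : ∀ d ∈ stdSet I, d 0 ≤ 2 ∧ d 1 + d 0 ≤ 4 ∧ d 2 ≤ 15) :
    Encodes (stdCodes [h 0 0, h 0 1, h 0 2, h 0 3, h 0 4] [h 1 0, h 1 1, h 1 2, h 1 3]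
      [h 2 0, h 2 1, h 2 2]) I := by
  have row : ∀ a b c, c < h a b → codePoint (160 * a + 20 * b + c) ∈ stdSet I := by
    intro a b c hc
    have hmem : expo a b c ∈ stdSet I := (hstd _).2 hc
    have := hbd _ hmem
    simp only [expo_zero, expo_one, expo_two] at this
    convert hmem using 1
    refine expo_ext ?_ ?_ ?_ <;> simp only [codePoint, expo_zero, expo_one, expo_two] <;> omega
  refine ⟨?_, fun d hd => ?_, fun d hd => ?_⟩
  · intro s hs
    simp only [stdCodes, List.mem_append, mem_rowCodes] at hs
    rcases hs with ⟨b, c, hc, rfl⟩ | ⟨b, c, hc, rfl⟩ | ⟨b, c, hc, rfl⟩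
    · refine row 0 b c ?_
      rcases b with _ | _ | _ | _ | _ | b <;>
        first | exact hc | exact absurd hc (Nat.not_lt_zero c)
    · refine row 1 b c ?_
      rcases b with _ | _ | _ | _ | b <;>
        first | exact hc | exact absurd hc (Nat.not_lt_zero c)
    · refine row 2 b c ?_
      rcases b with _ | _ | _ | b <;>
        first | exact hc | exact absurd hc (Nat.not_lt_zero c)
  · have := hbd d hd
    omega
  · obtain ⟨h0, h1, -⟩ := hbd d hd
    rw [hstd] at hd
    simp only [stdCodes, List.mem_append, mem_rowCodes, code]
    generalize d 0 = a at *
    generalize d 1 = b at *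
    interval_cases a
    · refine Or.inl ⟨b, d 2, ?_, by omega⟩
      have : b ≤ 4 := h1
      interval_cases b <;> exact hd
    · refine Or.inr (Or.inl ⟨b, d 2, ?_, by omega⟩)
      have : b ≤ 3 := by omega
      interval_cases b <;> exact hd
    · refine Or.inr (Or.inr ⟨b, d 2, ?_, by omega⟩)
      have : b ≤ 2 := by omega
      interval_cases b <;> exact hd

lemma nil_mem_stairs {u n : ℕ} (h : n = 0) : [] ∈ stairs [] u n := by
  subst h
  exact List.mem_singleton.2 rfl

lemma cons_mem_stairs {x u v n : ℕ} {r vs : List ℕ} (hu : x ≤ u) (hv : x ≤ v) (hn : x ≤ n)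
    (hr : r ∈ stairs vs (x - 1) (n - x)) : x :: r ∈ stairs (v :: vs) u n := by
  rw [stairs, List.mem_flatMap]
  exact ⟨x, List.mem_range.2 (by omega), List.mem_map.2 ⟨r, hr, rfl⟩⟩

lemma bounded_of_mem_ideals : ∀ p ∈ ideals,
    bounded (stdCodes p.1 p.2.1 p.2.2) sweep (target p.2.1 p.2.2) = true := by
  have h : (ideals.all fun p =>
    bounded (stdCodes p.1 p.2.1 p.2.2) sweep (target p.2.1 p.2.2)) = true := by decide +kernel
  exact List.all_eq_true.1 h

lemma rows_mem_ideals {h : ℕ → ℕ → ℕ} (h1 : ∀ a b, h a (b + 1) ≤ h a b - 1)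
    (h2 : ∀ a b, h (a + 1) b ≤ h a (b + 1))
    (hsum : h 0 0 + h 0 1 + h 0 2 + h 0 3 + h 0 4 + (h 1 0 + h 1 1 + h 1 2 + h 1 3) +
      (h 2 0 + h 2 1 + h 2 2) = 16) :
    ([h 0 0, h 0 1, h 0 2, h 0 3, h 0 4], [h 1 0, h 1 1, h 1 2, h 1 3], [h 2 0, h 2 1, h 2 2]) ∈
      ideals := by
  have a1 := h1 0 0
  have a2 := h1 0 1
  have a3 := h1 0 2
  have a4 := h1 0 3
  have b1 := h1 1 0
  have b2 := h1 1 1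
  have b3 := h1 1 2
  have c1 := h1 2 0
  have c2 := h1 2 1
  have d0 := h2 0 0
  have d1 := h2 0 1
  have d2 := h2 0 2
  have d3 := h2 0 3
  have e0 := h2 1 0
  have e1 := h2 1 1
  have e2 := h2 1 2
  clear h1 h2
  rw [ideals, List.mem_flatMap]
  refine ⟨h 0 0 + h 0 1 + h 0 2 + h 0 3 + h 0 4, List.mem_range.2 (by omega), ?_⟩
  rw [List.mem_flatMap]
  refine ⟨[h 0 0, h 0 1, h 0 2, h 0 3, h 0 4], ?_, ?_⟩
  · repeat' first | apply cons_mem_stairs | apply nil_mem_stairs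
    all_goals omega
  rw [List.mem_flatMap]
  refine ⟨h 1 0 + h 1 1 + h 1 2 + h 1 3, List.mem_range.2 (by omega), ?_⟩
  rw [List.mem_flatMap]
  refine ⟨[h 1 0, h 1 1, h 1 2, h 1 3], ?_, ?_⟩
  · rw [List.tail_cons]
    repeat' first | apply cons_mem_stairs | apply nil_mem_stairs
    all_goals omega
  rw [List.mem_map]
  refine ⟨[h 2 0, h 2 1, h 2 2], ?_, rfl⟩
  rw [List.tail_cons]
  repeat' first | apply cons_mem_stairs | apply nil_mem_stairs
  all_goals omega

lemma tangentDim_le_target {I : Ideal Poly3} (hI : IsMonomialIdeal I) (hB : IsBorelFixed I)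
    (hcol : Module.finrank ℂ (Poly3 ⧸ I) = 16) {m : ℕ} (hm : m ≤ 3) (hX : (X 0 : Poly3) ^ m ∈ I) :
    (∀ a, m ≤ a → height I a 0 = 0) ∧ Module.Finite ℂ (I →ₗ[Poly3] (Poly3 ⧸ I)) ∧
      tangentDim I ≤ target [height I 1 0, height I 1 1, height I 1 2, height I 1 3]
        [height I 2 0, height I 2 1, height I 2 2] := by
  rw [finrank_quotient hI] at hcol
  have hfin : (stdSet I).Finite := Set.finite_of_ncard_ne_zero (by omega)
  have h1 := height_succ_right hfin hB
  have h2 := height_succ_left_le hfin hB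
  have h3 := height_le_sub hfin hB
  have hzero : ∀ a, m ≤ a → height I a 0 = 0 := by
    intro a ha
    rw [← Nat.le_zero, ← monomial_mem_iff hfin]
    refine monomial_mem_of_le (expo_le_expo ha le_rfl le_rfl) ?_
    convert hX using 1
    rw [X_pow_eq_monomial]
    congr 2
    refine expo_ext ?_ ?_ ?_ <;> simp
  have h05 : ∀ b, 5 ≤ b → height I 0 b = 0 := by
    intro b hb
    induction b, hb using Nat.le_induction with
    | base =>
      have hsix := (card_columns hfin (Finset.range 1 ×ˢ Finset.range 6)).1
      simp only [Finset.sum_product, Finset.sum_range_succ, Finset.sum_range_zero, zero_add] at hsix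
      have e0 := h1 0 0
      have e1 := h1 0 1
      have e2 := h1 0 2
      have e3 := h1 0 3
      have e4 := h1 0 4
      simp only [zero_add, Nat.reduceAdd] at e0 e1 e2 e3 e4
      omega
    | succ b _ ih =>
      have := h1 0 b
      omega
  have hsupp : ∀ d ∈ stdSet I, d 2 < height I (d 0) (d 1) ∧ d 0 ≤ 2 ∧ d 1 + d 0 ≤ 4 := by
    intro d hd
    rw [mem_stdSet_iff hfin] at hd
    refine ⟨hd, ?_, ?_⟩ <;> by_contra! hlt
    · have := h3 (d 0) (d 1)
      have := hzero (d 0) (by omega)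
      omega
    · have := height_le_height_zero hfin hB (d 0) (d 1)
      have := h05 (d 1 + d 0) (by omega)
      omega
  have hsum := (card_columns hfin
    ({(0, 0), (0, 1), (0, 2), (0, 3), (0, 4), (1, 0), (1, 1), (1, 2), (1, 3), (2, 0), (2, 1),
      (2, 2)} : Finset (ℕ × ℕ))).2 fun d hd => by
    have := hsupp d hd
    simp only [Finset.mem_insert, Finset.mem_singleton, Prod.mk.injEq]
    omega
  rw [hcol] at hsum
  simp only [Finset.mem_insert, Finset.mem_singleton, Prod.mk.injEq, Finset.sum_insert,
    Finset.sum_singleton, OfNat.zero_ne_ofNat, zero_ne_one, one_ne_zero,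
    false_and, and_false, or_false, not_false_eq_true, OfNat.ofNat_ne_zero, OfNat.ofNat_ne_one,
    OfNat.one_ne_ofNat, Nat.reduceEqDiff] at hsum
  have hcode := bounded_of_mem_ideals _ (rows_mem_ideals h1 h2 (by omega))
  refine ⟨hzero, Encodes.tangentDim_le
    (encodes_stdCodes (mem_stdSet_iff hfin) fun d hd => ?_) hI hcode⟩
  obtain ⟨hd, h0, hd1⟩ := hsupp d hd
  refine ⟨h0, hd1, ?_⟩
  have := height_le_height_zero hfin hB (d 0) (d 1)
  have := h3 0 (d 1 + d 0)
  omega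

/-- Column heights of a Borel-fixed ideal. -/
structure IsBorelHeight (h : ℕ → ℕ → ℕ) : Prop where
  succ_right : ∀ a b, h a (b + 1) ≤ h a b - 1
  succ_left_le : ∀ a b, h (a + 1) b ≤ h a (b + 1)

/-- The monomial ideal with given column heights. -/
noncomputable def columnIdeal (h : ℕ → ℕ → ℕ) : Ideal Poly3 :=
  Ideal.span ((fun d => monomial d (1 : ℂ)) '' {d | h (d 0) (d 1) ≤ d 2})

section columnIdeal

variable {h : ℕ → ℕ → ℕ} (hh : IsBorelHeight h)
include hh

lemma IsBorelHeight.anti {a a' b b' : ℕ} (ha : a ≤ a') (hb : b ≤ b') : h a' b' ≤ h a b := by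
  have h1 : ∀ a, Antitone (h a) := fun a =>
    antitone_nat_of_succ_le fun b => (hh.succ_right a b).trans (Nat.sub_le _ _)
  have h2 : Antitone fun a => h a b := antitone_nat_of_succ_le fun a =>
    (hh.succ_left_le a b).trans (h1 a (Nat.le_succ b))
  exact (h1 a' hb).trans (h2 ha)

lemma IsBorelHeight.mem_columnIdeal (p : Poly3) :
    p ∈ columnIdeal h ↔ ∀ d ∈ p.support, h (d 0) (d 1) ≤ d 2 := by
  rw [columnIdeal, mem_ideal_span_monomial_image]
  refine forall₂_congr fun d _ => ⟨?_, fun hd => ⟨d, hd, le_rfl⟩⟩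
  rintro ⟨e, he, hle⟩
  exact (hh.anti (hle 0) (hle 1)).trans (he.trans (hle 2))

lemma IsBorelHeight.monomial_mem (d : Fin 3 →₀ ℕ) :
    monomial d (1 : ℂ) ∈ columnIdeal h ↔ h (d 0) (d 1) ≤ d 2 := by
  rw [hh.mem_columnIdeal, support_monomial, if_neg one_ne_zero]
  simp

lemma IsBorelHeight.mem_stdSet (d : Fin 3 →₀ ℕ) :
    d ∈ stdSet (columnIdeal h) ↔ d 2 < h (d 0) (d 1) := by
  rw [← not_le, ← hh.monomial_mem]
  rfl

lemma IsBorelHeight.isMonomialIdeal : IsMonomialIdeal (columnIdeal h) := fun p hp d hd =>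
  (hh.monomial_mem d).2 ((hh.mem_columnIdeal p).1 hp d hd)

lemma IsBorelHeight.isBorelFixed : IsBorelFixed (columnIdeal h) := by
  intro d hd i j hij hj
  rw [hh.monomial_mem] at hd ⊢
  have h1 := hh.succ_right (d 0) (d 1)
  have h2 := hh.succ_left_le (d 0) (d 1)
  have h3 := hh.succ_left_le (d 0) (d 1 - 1)
  fin_cases i <;> fin_cases j <;> simp at hij hj ⊢
  · rw [Nat.sub_add_cancel hj] at h3
    exact h3.trans hd
  · omega
  · omega

lemma IsBorelHeight.X_pow_mem (m : ℕ) : (X 0 : Poly3) ^ m ∈ columnIdeal h ↔ h m 0 = 0 := by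
  rw [X_pow_eq_monomial, hh.monomial_mem]
  simp

variable (hleft : h 3 0 = 0) (hright : h 0 5 = 0)
include hleft hright

lemma IsBorelHeight.lt_of_mem {d : Fin 3 →₀ ℕ} (hd : d ∈ stdSet (columnIdeal h)) :
    d 0 < 3 ∧ d 1 < 5 := by
  rw [hh.mem_stdSet] at hd
  refine ⟨?_, ?_⟩ <;> by_contra! hlt
  · have := hh.anti hlt (Nat.zero_le (d 1))
    omega
  · have := hh.anti (Nat.zero_le (d 0)) hlt
    omega

lemma IsBorelHeight.finite_stdSet : (stdSet (columnIdeal h)).Finite := by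
  refine (Set.finite_Iic (expo 3 5 (h 0 0))).subset fun d hd i => ?_
  have h1 := hh.lt_of_mem hleft hright hd
  rw [hh.mem_stdSet] at hd
  have h2 := hh.anti (Nat.zero_le (d 0)) (Nat.zero_le (d 1))
  fin_cases i
  · exact h1.1.le
  · exact h1.2.le
  · exact (hd.trans_le h2).le

lemma IsBorelHeight.finrank_eq :
    Module.finrank ℂ (Poly3 ⧸ columnIdeal h) =
      ∑ p ∈ Finset.range 3 ×ˢ Finset.range 5, h p.1 p.2 := by
  have hfin := hh.finite_stdSet hleft hright
  have heq : ∀ a b, height (columnIdeal h) a b = h a b := fun a b =>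
    eq_of_forall_ge_iff fun c => by rw [← monomial_mem_iff hfin, hh.monomial_mem]; rfl
  have hsum := (card_columns hfin (Finset.range 3 ×ˢ Finset.range 5)).2 fun d hd => by
    simpa using hh.lt_of_mem hleft hright hd
  rw [finrank_quotient hh.isMonomialIdeal, ← hsum]
  simp_rw [heq]

end columnIdeal

/-- The exponent whose coordinates are the decimal digits of `k`. -/
noncomputable def digitPoint (k : ℕ) : Fin 3 →₀ ℕ := expo (k / 100) (k / 10 % 10) (k % 10)

/-- The change of the index of a point under multiplication by a variable. -/
def digitWeight : Fin 3 → ℕ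
  | 0 => 100
  | 1 => 10
  | 2 => 1

/-- A decimal digit of `k`. -/
def digit (k : ℕ) : Fin 3 → ℕ
  | 0 => k / 100
  | 1 => k / 10 % 10
  | 2 => k % 10

/-- The point with index `k` lies below the given column heights. -/
def Below (h : ℕ → ℕ → ℕ) (k : ℕ) : Prop := k % 10 < h (k / 100) (k / 10 % 10)

instance (h : ℕ → ℕ → ℕ) (k : ℕ) : Decidable (Below h k) := inferInstanceAs (Decidable (_ < _))

/-- The set of pairs `C`, where `1000 * m + s` stands for the pair of points `m` and `s`, is closed
under admissible moves and contains no pair at which all homomorphisms vanish. -/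
def ClosedOrbit (h : ℕ → ℕ → ℕ) (C : List ℕ) : Prop :=
  ∀ k ∈ C, ∀ i, digit (k / 1000) i < 9 ∧ digit (k % 1000) i < 9 ∧
    (Below h (k % 1000 + digitWeight i) → k + 1001 * digitWeight i ∈ C) ∧
    (digit (k / 1000) i ≠ 0 → ¬ Below h (k / 1000 - digitWeight i) →
      digit (k % 1000) i ≠ 0 ∧ k - 1001 * digitWeight i ∈ C)

instance (h : ℕ → ℕ → ℕ) (C : List ℕ) : Decidable (ClosedOrbit h C) :=
  inferInstanceAs (Decidable (∀ k ∈ C, ∀ _, _ ∧ _ ∧ (_ → _) ∧ (_ → _ → _ ∧ _)))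

lemma digitPoint_apply (k : ℕ) (i : Fin 3) : digitPoint k i = digit k i := by
  fin_cases i <;> rfl

lemma digitPoint_injective : Function.Injective digitPoint := by
  intro k l hkl
  have h0 : k / 100 = l / 100 := DFunLike.congr_fun hkl 0
  have h1 : k / 10 % 10 = l / 10 % 10 := DFunLike.congr_fun hkl 1
  have h2 : k % 10 = l % 10 := DFunLike.congr_fun hkl 2
  omega

lemma digitPoint_add {k : ℕ} {i : Fin 3} (hk : digit k i < 9) :
    digitPoint (k + digitWeight i) = digitPoint k + Finsupp.single i 1 := by
  fin_cases i <;> refine expo_ext ?_ ?_ ?_ <;> simp [digitPoint, digitWeight, digit] at hk ⊢ <;>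
    omega

lemma digitPoint_sub {k : ℕ} {i : Fin 3} (hk : digit k i ≠ 0) :
    digitPoint (k - digitWeight i) + Finsupp.single i 1 = digitPoint k := by
  fin_cases i <;> refine expo_ext ?_ ?_ ?_ <;> simp [digitPoint, digitWeight, digit] at hk ⊢ <;>
    omega

/-- The pair of exponents with index in `C`. -/
def InOrbit (C : List ℕ) (d s : Fin 3 →₀ ℕ) : Prop :=
  ∃ k ∈ C, d = digitPoint (k / 1000) ∧ s = digitPoint (k % 1000)

section orbit

variable {h : ℕ → ℕ → ℕ} (hh : IsBorelHeight h)
include hh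

lemma IsBorelHeight.digitPoint_mem (k : ℕ) : digitPoint k ∈ stdSet (columnIdeal h) ↔ Below h k :=
  hh.mem_stdSet _

variable {C : List ℕ} (hC : ClosedOrbit h C)
include hC

lemma IsBorelHeight.inOrbit_pred {d t : Fin 3 →₀ ℕ} {i : Fin 3}
    (hd : monomial d (1 : ℂ) ∈ columnIdeal h) (ht : InOrbit C (d + Finsupp.single i 1) t) :
    t i ≠ 0 ∧ InOrbit C d (t - Finsupp.single i 1) := by
  obtain ⟨k, hk, h1, rfl⟩ := ht
  obtain ⟨-, -, -, h2⟩ := hC k hk i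
  have hne : digit (k / 1000) i ≠ 0 := by
    rw [← digitPoint_apply, ← h1]
    simp
  have hd' : digitPoint (k / 1000 - digitWeight i) = d := by
    rw [← digitPoint_sub hne] at h1
    exact (add_right_cancel h1).symm
  obtain ⟨h3, h4⟩ := h2 hne (by rwa [← hh.digitPoint_mem, hd', stdSet, Set.mem_ofPred_eq, not_not])
  refine ⟨by rwa [digitPoint_apply], _, h4, ?_, ?_⟩
  · rw [← hd']
    congr 1
    fin_cases i <;> simp [digitWeight, digit] at hne h3 ⊢ <;> omega
  · rw [← digitPoint_sub h3, add_tsub_cancel_right]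
    congr 1
    fin_cases i <;> simp [digitWeight, digit] at hne h3 ⊢ <;> omega

lemma IsBorelHeight.inOrbit_succ {d t : Fin 3 →₀ ℕ} {i : Fin 3}
    (hs : t + Finsupp.single i 1 ∈ stdSet (columnIdeal h)) (ht : InOrbit C d t) :
    InOrbit C (d + Finsupp.single i 1) (t + Finsupp.single i 1) := by
  obtain ⟨k, hk, rfl, rfl⟩ := ht
  obtain ⟨h1, h2, h3, -⟩ := hC k hk i
  rw [← digitPoint_add h2, hh.digitPoint_mem] at hs
  refine ⟨_, h3 hs, ?_, ?_⟩
  · rw [← digitPoint_add h1]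
    congr 1
    fin_cases i <;> simp [digitWeight, digit] at h2 ⊢ <;> omega
  · rw [← digitPoint_add h2]
    congr 1
    fin_cases i <;> simp [digitWeight, digit] at h2 ⊢ <;> omega

end orbit

/-- The closed sets in `L` are nonempty and their first elements lie in no other set of `L`. -/
def IndependentOrbits (h : ℕ → ℕ → ℕ) (L : List (List ℕ)) : Prop :=
  (∀ C ∈ L, ClosedOrbit h C) ∧
  (∀ C ∈ L, ¬ Below h (C.headD 0 / 1000) ∧ Below h (C.headD 0 % 1000)) ∧
  ∀ j k : Fin L.length, L[k].headD 0 ∈ L[j] ↔ j = k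

instance (h : ℕ → ℕ → ℕ) (L : List (List ℕ)) : Decidable (IndependentOrbits h L) :=
  inferInstanceAs (Decidable (_ ∧ _ ∧ _))

lemma IsBorelHeight.le_tangentDim {h : ℕ → ℕ → ℕ} (hh : IsBorelHeight h)
    (hfin : (stdSet (columnIdeal h)).Finite)
    (hHom : Module.Finite ℂ (columnIdeal h →ₗ[Poly3] (Poly3 ⧸ columnIdeal h)))
    {L : List (List ℕ)} (hL : IndependentOrbits h L) : L.length ≤ tangentDim (columnIdeal h) := by
  classical
  obtain ⟨hcl, hhead, hind⟩ := hL
  refine _root_.le_tangentDim hh.isMonomialIdeal hfin hHom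
    (fun j d s => if InOrbit L[j] d s then 1 else 0) ?_ ?_
    (fun k => digitPoint (L[k].headD 0 / 1000)) (fun k => digitPoint (L[k].headD 0 % 1000))
    (fun k => ?_) (fun k => ?_) (fun j k => ?_)
  · intro j d t i hd ht
    have hC := hcl L[j] (List.getElem_mem _)
    refine if_congr ⟨fun ho => ?_, hh.inOrbit_succ hC ht⟩ rfl rfl
    have := (hh.inOrbit_pred hC hd ho).2
    rwa [add_tsub_cancel_right] at this
  · intro j d t i hd _ ht
    exact if_neg fun ho => (hh.inOrbit_pred (hcl L[j] (List.getElem_mem _)) hd ho).1 ht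
  · have := (hhead L[k] (List.getElem_mem _)).1
    rwa [← hh.digitPoint_mem, stdSet, Set.mem_ofPred_eq, not_not] at this
  · exact (hh.digitPoint_mem _).2 (hhead L[k] (List.getElem_mem _)).2
  · refine if_congr (Iff.trans ⟨?_, fun hm => ⟨_, hm, rfl, rfl⟩⟩ (hind j k)) rfl rfl
    rintro ⟨l, hl, h1, h2⟩
    have h1 := digitPoint_injective h1
    have h2 := digitPoint_injective h2
    rwa [show L[k].headD 0 = l by omega]

/-- Column heights given by a finite table. -/
def tableHeight (rows : List (List ℕ)) (a b : ℕ) : ℕ := (rows.getD a []).getD b 0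

/-- The column heights of the ideal that is maximal for `m1 = 2`. -/
def rows₂ : List (List ℕ) := [[4, 3, 2, 1], [3, 2, 1]]

/-- The column heights of the ideal that is maximal for `m1 = 3`. -/
def rows₃ : List (List ℕ) := [[5, 3, 2, 1], [3, 1], [1]]

/-- Supports of a basis of the tangent space at the ideal with column heights `rows₂`. -/
def orbits₂ : List (List ℕ) :=
  [[4003], [4012], [4021], [4030], [4102], [4111], [4120], [13003], [13012], [13021], [13030],
   [13102], [13111], [13120], [22003], [22012], [22021], [22030], [22102], [22111], [22120],
   [31003], [31012], [31021], [31030], [31102], [31111], [31120], [40003], [40012], [40021],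
   [40030], [40102], [40111], [40120], [103003], [103012], [103021], [103030], [103102], [103111],
   [103120], [112003], [112012], [112021], [112030], [112102], [112111], [112120], [121003],
   [121012], [121021], [121030], [121102], [121111], [121120], [130003], [130012], [130021],
   [130030], [130102], [130111], [130120],
   [200001, 300101, 210011, 201002, 301102, 211012, 202003, 310111, 220021],
   [200002, 300102, 210012, 201003], [200003],
   [200010, 300110, 210020, 201011, 301111, 211021, 202012, 310120, 220030],
   [200011, 300111, 210021, 201012], [200012], [200020, 300120, 210030, 201021], [200021],
   [200030], [200100, 210110, 201101, 211111, 202102, 220120], [200101, 210111, 201102], [200102],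
   [200110, 210120, 201111], [200111], [200120]]

/-- Supports of a basis of the tangent space at the ideal with column heights `rows₃`. -/
def orbits₃ : List (List ℕ) :=
  [[5003, 6004], [5004], [5012], [5021], [5030], [5101, 6102], [5102], [5110], [5200],
   [13003, 14004], [13004], [13012], [13021], [13030], [13101, 14102], [13102], [13110], [13200],
   [22004], [22012], [22021], [22030], [22102], [22110], [22200], [31004], [31012], [31021],
   [31030], [31102], [31110], [31200], [40004], [40012], [40021], [40030], [40102], [40110],
   [40200], [103003, 104004], [103004], [103012], [103021], [103030], [103101, 104102], [103102],
   [103110], [103200], [111003, 112004], [111004], [111011, 121021, 112012, 120020, 130030],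
   [111012], [111021], [111030], [111101, 112102], [111102], [111110], [111200], [120004],
   [120012], [120021], [120030], [120102], [120110], [120200], [201003, 202004], [201004],
   [201012], [201021], [201030], [201101, 202102], [201102], [201110], [201200], [210004],
   [210012], [210021], [210030], [210102], [210110], [210200], [300004], [300012], [300021],
   [300030], [300102], [300110], [300200]]

lemma isBorelHeight_rows₂ : IsBorelHeight (tableHeight rows₂) := by
  constructor <;> intro a b <;> rcases a with _ | _ | _ | a <;>
    rcases b with _ | _ | _ | _ | _ | b <;> simp [tableHeight, rows₂]

lemma isBorelHeight_rows₃ : IsBorelHeight (tableHeight rows₃) := by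
  constructor <;> intro a b <;> rcases a with _ | _ | _ | a <;>
    rcases b with _ | _ | _ | _ | _ | b <;> simp [tableHeight, rows₃]

lemma independentOrbits₂ : IndependentOrbits (tableHeight rows₂) orbits₂ := by decide +kernel

lemma independentOrbits₃ : IndependentOrbits (tableHeight rows₃) orbits₃ := by decide +kernel

lemma tangentDim_le_of_colength {I : Ideal Poly3} (hI : IsMonomialIdeal I) (hB : IsBorelFixed I)
    (hcol : Module.finrank ℂ (Poly3 ⧸ I) = 16) {m : ℕ} (hm : m ≤ 3) (hX : (X 0 : Poly3) ^ m ∈ I) :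
    Module.Finite ℂ (I →ₗ[Poly3] (Poly3 ⧸ I)) ∧
      tangentDim I ≤ if m ≤ 1 then 77 else if m ≤ 2 then 78 else 88 := by
  obtain ⟨hzero, hfin, hle⟩ := tangentDim_le_target hI hB hcol hm hX
  refine ⟨hfin, hle.trans ?_⟩
  split_ifs with h1 h2
  · rw [hzero 1 (by omega), hzero 2 (by omega)]
    rfl
  · rw [hzero 2 (by omega)]
    unfold target
    split <;> simp_all
  · unfold target
    split <;> simp

/-- A Borel-fixed ideal of colength 16 attaining the upper bound. -/
lemma tmaxEq_of_orbits {h : ℕ → ℕ → ℕ} (hh : IsBorelHeight h) (hright : h 0 5 = 0) {m T : ℕ}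
    (hm : m ≤ 3) (hmem : h m 0 = 0) (hnot : h (m - 1) 0 ≠ 0)
    (hsum : ∑ p ∈ Finset.range 3 ×ˢ Finset.range 5, h p.1 p.2 = 16)
    {L : List (List ℕ)} (hL : IndependentOrbits h L) (hlen : L.length = T)
    (hT : (if m ≤ 1 then 77 else if m ≤ 2 then 78 else 88) = T) : TmaxEq 16 m T := by
  have hleft : h 3 0 = 0 := Nat.le_zero.1 ((hh.anti hm le_rfl).trans_eq hmem)
  have hcol := (hh.finrank_eq hleft hright).trans hsum
  obtain ⟨hHom, hle⟩ := tangentDim_le_of_colength hh.isMonomialIdeal hh.isBorelFixed hcol hm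
    ((hh.X_pow_mem m).2 hmem)
  refine ⟨⟨columnIdeal h, hh.isMonomialIdeal, hh.isBorelFixed, hcol, (hh.X_pow_mem m).2 hmem,
    fun hX => hnot ((hh.X_pow_mem _).1 hX), le_antisymm ?_ (hT ▸ hle)⟩, ?_⟩
  · exact hlen ▸ hh.le_tangentDim (hh.finite_stdSet hleft hright) hHom hL
  · rintro t ⟨I, hI, hB, hcol, hX, -, rfl⟩
    exact hT ▸ (tangentDim_le_of_colength hI hB hcol hm hX).2

theorem Tmax_monotonicity_l16 :
    TmaxEq 16 2 78 ∧
    TmaxEq 16 3 88 ∧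
    (∀ T1 T2 T3 : ℕ, TmaxEq 16 1 T1 → TmaxEq 16 2 T2 → TmaxEq 16 3 T3 →
      T1 < T2 ∧ T2 < T3) := by
  have h2 : TmaxEq 16 2 78 := tmaxEq_of_orbits isBorelHeight_rows₂ rfl (by decide) rfl (by decide)
    (by decide) independentOrbits₂ rfl rfl
  have h3 : TmaxEq 16 3 88 := tmaxEq_of_orbits isBorelHeight_rows₃ rfl (by decide) rfl (by decide)
    (by decide) independentOrbits₃ rfl rfl
  refine ⟨h2, h3, fun T1 T2 T3 hT1 hT2 hT3 => ?_⟩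
  obtain ⟨⟨I, hI, hB, hcol, hX, -, rfl⟩, -⟩ := hT1
  have h1 : tangentDim I ≤ 77 := (tangentDim_le_of_colength hI hB hcol (by decide) hX).2
  rw [hT2.unique h2, hT3.unique h3]
  omega
end
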